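/- Let A be a (not necessarily irreducible) Coxeter arrangement with Coxeter group W, D a primitive derivation of W, and m : A → ℤ an arbitrary multiplicity. Then the primitive filtration P_k^{(m)} := ∇_D^k Ω(A,m)^W (k ∈ ℤ) is an increasing filtration ⋯ ⊂ P_{−1}^{(m)} ⊂ P_0^{(m)} ⊂ P_1^{(m)} ⊂ ⋯ of Ω(A,∞)^W, and for every k ∈ ℤ one has P_k^{(m)} = P_0^{(m+2k)} = Ω(A, m+2k)^W, where (m+2k)(H) = m(H) + 2k for H ∈ A. -/

import Mathlib

open MvPolynomial

noncomputable section CoxeterFormalization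

/-! ### The ambient rings: `S = Sym(V*)`, `F = Frac(S)`, rational 1-forms.

We model the `ℓ`-dimensional Euclidean space `V` as `ℝ^ℓ` with its standard
(orthonormal) coordinates, so that `S = ℝ[x_0, …, x_{ℓ-1}]`, and a rational
differential 1-form `ω = Σ ω_x dx_x` (equivalently, a rational derivation
`ξ = Σ ξ_x ∂_x`) is recorded by its component vector `(ω_x)_x : Fin ℓ → F`. -/

abbrev Spoly (ℓ : ℕ) := MvPolynomial (Fin ℓ) ℝ
abbrev Ffield (ℓ : ℕ) := FractionRing (Spoly ℓ)
abbrev OmF (ℓ : ℕ) := Fin ℓ → Ffield ℓ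

variable {ℓ t : ℕ}

/-- The image of `S` in `F`: the "regular" (polynomial) rational functions. -/
def Sreg (ℓ : ℕ) : Set (Ffield ℓ) := Set.range (algebraMap (Spoly ℓ) (Ffield ℓ))

def toF (p : Spoly ℓ) : Ffield ℓ := algebraMap (Spoly ℓ) (Ffield ℓ) p

/-- The linear form `α = Σ a_x · x_x ∈ V*` attached to a normal vector `a`. -/
def linForm (a : Fin ℓ → ℝ) : Spoly ℓ := ∑ x, MvPolynomial.C (a x) * MvPolynomial.X x

def linF (a : Fin ℓ → ℝ) : Ffield ℓ := toF (linForm a)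

def cF (r : ℝ) : Ffield ℓ := toF (MvPolynomial.C r)

def XF (x : Fin ℓ) : Ffield ℓ := toF (MvPolynomial.X x)

/-- `Q = ∏_{H ∈ A} α_H`, as an element of `F`. -/
def QF (A : Finset (Fin ℓ → ℝ)) : Ffield ℓ := toF (∏ a ∈ A, linForm a)

/-- `Q^m = ∏_{H ∈ A} α_H^{m(H)}` for an integral multiplicity `m`. -/
def QmF (A : Finset (Fin ℓ → ℝ)) (m : (Fin ℓ → ℝ) → ℤ) : Ffield ℓ :=
  ∏ a ∈ A, linF a ^ m a

/-- Ziegler's module `Ω(A,∞)` of logarithmic 1-forms: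
`Q^N ω` and `(Q/α_H)^N dα_H ∧ ω` regular for `N ≫ 0`.  The wedge
`dα_H ∧ ω` is recorded by its components `a_x ω_y - a_y ω_x`. -/
def OmegaInf (A : Finset (Fin ℓ → ℝ)) : Set (OmF ℓ) :=
  {ω | ∃ N : ℕ,
    (∀ x, QF A ^ N * ω x ∈ Sreg ℓ) ∧
    ∀ a ∈ A, ∀ x y,
      (QF A / linF a) ^ N * (cF (a x) * ω y - cF (a y) * ω x) ∈ Sreg ℓ}

/-- `Ω(A,m)` for an arbitrary multiplicity `m : A → ℤ`: those `ω ∈ Ω(A,∞)` with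
`(Q/α_H)^N α_H^{m(H)} I*(dα_H, ω) ∈ S` for `N ≫ 0`; here
`I*(dα_H, ω) = Σ_x a_x ω_x` (the coordinates are orthonormal). -/
def OmegaMult (A : Finset (Fin ℓ → ℝ)) (m : (Fin ℓ → ℝ) → ℤ) : Set (OmF ℓ) :=
  {ω ∈ OmegaInf A | ∃ N : ℕ,
    ∀ a ∈ A, (QF A / linF a) ^ N * linF a ^ m a * (∑ x, cF (a x) * ω x) ∈ Sreg ℓ}

/-! ### The action of `GL_ℓ(ℝ)` on `S`, `F` and on component vectors. -/

/-- Substitution `x_i ↦ Σ_j M_{i j} x_j`, i.e. `f ↦ f ∘ M`. -/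
def matSub (M : Matrix (Fin ℓ) (Fin ℓ) ℝ) : Spoly ℓ →ₐ[ℝ] Spoly ℓ :=
  MvPolynomial.aeval fun x => ∑ y, MvPolynomial.C (M x y) * MvPolynomial.X y

lemma matSub_comp (M N : Matrix (Fin ℓ) (Fin ℓ) ℝ) :
    (matSub M).comp (matSub N) = matSub (N * M) := by
  apply MvPolynomial.algHom_ext
  intro x
  simp only [matSub, AlgHom.coe_comp, Function.comp_apply, aeval_X, map_sum, map_mul, aeval_C,
    Matrix.mul_apply, C_mul, Finset.sum_mul, Finset.mul_sum, MvPolynomial.algebraMap_eq,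
    mul_assoc]
  rw [Finset.sum_comm]

lemma matSub_one : matSub (1 : Matrix (Fin ℓ) (Fin ℓ) ℝ) = AlgHom.id ℝ (Spoly ℓ) := by
  apply MvPolynomial.algHom_ext
  intro x
  simp [matSub, Matrix.one_apply, apply_ite MvPolynomial.C, ite_mul, Finset.sum_ite_eq]

lemma matSub_injective (g : Matrix.GeneralLinearGroup (Fin ℓ) ℝ) :
    Function.Injective (matSub (↑g : Matrix (Fin ℓ) (Fin ℓ) ℝ)) := by
  intro p q h
  have h3 : (matSub (↑g⁻¹ : Matrix (Fin ℓ) (Fin ℓ) ℝ)).comp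
      (matSub (↑g : Matrix (Fin ℓ) (Fin ℓ) ℝ)) = AlgHom.id ℝ (Spoly ℓ) := by
    rw [matSub_comp]
    have h1 : ((↑g : Matrix (Fin ℓ) (Fin ℓ) ℝ) * (↑g⁻¹ : Matrix (Fin ℓ) (Fin ℓ) ℝ))
        = (1 : Matrix (Fin ℓ) (Fin ℓ) ℝ) := by
      rw [← Units.val_mul]; simp
    rw [h1, matSub_one]
  have h2 := congrArg (matSub (↑g⁻¹ : Matrix (Fin ℓ) (Fin ℓ) ℝ)) h
  rwa [← AlgHom.comp_apply, ← AlgHom.comp_apply, h3, AlgHom.id_apply, AlgHom.id_apply] at h2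

/-- The action of `g ∈ GL_ℓ(ℝ)` on rational functions, `f ↦ f ∘ g⁻¹`. -/
def fAct (g : Matrix.GeneralLinearGroup (Fin ℓ) ℝ) : Ffield ℓ →+* Ffield ℓ :=
  IsFractionRing.lift (g :=
    (algebraMap (Spoly ℓ) (Ffield ℓ)).comp
      (matSub (↑g⁻¹ : Matrix (Fin ℓ) (Fin ℓ) ℝ)).toRingHom)
    ((IsFractionRing.injective (Spoly ℓ) (Ffield ℓ)).comp (matSub_injective g⁻¹))

/-- The natural action of an **orthogonal** `g` on the component vector of a
differential 1-form (equivalently, of a derivation): `(g·v)_x = Σ_y g_{x y} · g(v_y)`. -/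
def vecAct (g : Matrix.GeneralLinearGroup (Fin ℓ) ℝ) (v : OmF ℓ) : OmF ℓ :=
  fun x => ∑ y, cF ((↑g : Matrix (Fin ℓ) (Fin ℓ) ℝ) x y) * fAct g (v y)

/-- `W`-invariant component vectors (1-forms/derivations). -/
def InvVec (W : Subgroup (Matrix.GeneralLinearGroup (Fin ℓ) ℝ)) : Set (OmF ℓ) :=
  {ω | ∀ g ∈ W, vecAct g ω = ω}

/-- `Ω(A,∞)^W`. -/
def OmegaInfW (A : Finset (Fin ℓ → ℝ)) (W : Subgroup (Matrix.GeneralLinearGroup (Fin ℓ) ℝ)) :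
    Set (OmF ℓ) := OmegaInf A ∩ InvVec W

/-- `Ω(A,m)^W = Ω(A,m) ∩ Ω(A,∞)^W`. -/
def OmegaMultW (A : Finset (Fin ℓ → ℝ)) (W : Subgroup (Matrix.GeneralLinearGroup (Fin ℓ) ℝ))
    (m : (Fin ℓ → ℝ) → ℤ) : Set (OmF ℓ) := OmegaMult A m ∩ InvVec W

/-- `W`-invariant polynomials. -/
def InvPoly (W : Subgroup (Matrix.GeneralLinearGroup (Fin ℓ) ℝ)) : Set (Spoly ℓ) :=
  {p | ∀ g ∈ W, matSub (↑g : Matrix (Fin ℓ) (Fin ℓ) ℝ) p = p}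

/-- The invariant ring `R = S^W`, viewed inside `F`. -/
def RF (W : Subgroup (Matrix.GeneralLinearGroup (Fin ℓ) ℝ)) : Set (Ffield ℓ) :=
  toF '' InvPoly W

/-- The orthogonal reflection through the hyperplane `ker⟨a, ·⟩`. -/
def reflMat (a : Fin ℓ → ℝ) : Matrix (Fin ℓ) (Fin ℓ) ℝ :=
  1 - (2 / ∑ x, a x * a x) • Matrix.vecMulVec a a

/-! ### Block (irreducible-factor) structure. -/

/-- A polynomial involving only the variables of the block `i` (w.r.t. the block
assignment `blk : Fin ℓ → Fin t`). -/
def blockPoly (blk : Fin ℓ → Fin t) (i : Fin t) (p : Spoly ℓ) : Prop :=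
  ∀ m ∈ p.support, ∀ x ∈ Finsupp.support m, blk x = i

/-- Rational functions in the variables of block `i` only. -/
def blockFrac (blk : Fin ℓ → Fin t) (i : Fin t) : Set (Ffield ℓ) :=
  {y | ∃ p q : Spoly ℓ, blockPoly blk i p ∧ blockPoly blk i q ∧ q ≠ 0 ∧ y * toF q = toF p}

/-- A component vector belonging to the factor `V[i]`:  components outside block `i`
vanish and all components are rational functions of the block-`i` variables. -/
def BlockVec (blk : Fin ℓ → Fin t) (i : Fin t) (ω : OmF ℓ) : Prop :=
  (∀ x, blk x ≠ i → ω x = 0) ∧ ∀ x, ω x ∈ blockFrac blk i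

/-- All the data of a (not necessarily irreducible) Coxeter arrangement `A` in the
Euclidean space `V = ℝ^ℓ`, together with its decomposition into `t` irreducible
factors and a system of basic invariants:

* `A` is a finite set of hyperplanes, recorded by nonzero defining normal vectors,
  pairwise non-proportional;
* `W` is a finite subgroup of `GL_ℓ(ℝ)` consisting of orthogonal transformations,
  generated by the reflections through the members of `A`, and `A` is exactly the
  set of reflecting hyperplanes of `W` (so `A` is the Coxeter arrangement of the
  finite real reflection group `W`);
* `blk` assigns to every coordinate its irreducible block `V[i]`, every hyperplane
  of `A` lies over a single block;
* `P c` (`c : Fin ℓ`) are basic invariants: homogeneous, `W`-invariant,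
  algebraically independent generators of `R = S^W`, the invariants of the block `i`
  being those `P c` with `blk c = i` and involving only block-`i` variables;
* within each block `i` the invariant `P (top i)` has strictly largest degree
  (this uses irreducibility of the factors; it makes the primitive derivations
  `D[i] = ∂/∂P_{ℓ[i]}[i]` well defined up to constants). -/
structure CoxeterSetup (ℓ t : ℕ) where
  A : Finset (Fin ℓ → ℝ)
  W : Subgroup (Matrix.GeneralLinearGroup (Fin ℓ) ℝ)
  hA0 : ∀ a ∈ A, a ≠ 0
  hAprop : ∀ a ∈ A, ∀ b ∈ A, (∃ c : ℝ, a = c • b) → a = b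
  hWfin : (W : Set (Matrix.GeneralLinearGroup (Fin ℓ) ℝ)).Finite
  hWorth : ∀ g ∈ W, Matrix.transpose (↑g : Matrix (Fin ℓ) (Fin ℓ) ℝ) * (↑g : Matrix (Fin ℓ) (Fin ℓ) ℝ) = 1
  hrefl : ∀ a ∈ A, ∃ g ∈ W, (↑g : Matrix (Fin ℓ) (Fin ℓ) ℝ) = reflMat a
  hhyp : ∀ g ∈ W, ∀ a : Fin ℓ → ℝ, a ≠ 0 → (↑g : Matrix (Fin ℓ) (Fin ℓ) ℝ) = reflMat a →
    ∃ b ∈ A, ∃ c : ℝ, a = c • b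
  hgen : W = Subgroup.closure
    {g : Matrix.GeneralLinearGroup (Fin ℓ) ℝ | ∃ a ∈ A, (↑g : Matrix (Fin ℓ) (Fin ℓ) ℝ) = reflMat a}
  blk : Fin ℓ → Fin t
  hblkA : ∀ a ∈ A, ∃ i, ∀ x, a x ≠ 0 → blk x = i
  P : Fin ℓ → MvPolynomial (Fin ℓ) ℝ
  deg : Fin ℓ → ℕ
  hdeg : ∀ c, 0 < deg c
  hPhom : ∀ c, (P c).IsHomogeneous (deg c)
  hPblock : ∀ c, blockPoly blk (blk c) (P c)
  hPinv : ∀ c, P c ∈ InvPoly W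
  hPind : AlgebraicIndependent ℝ P
  hPgen : ∀ p : Spoly ℓ, p ∈ InvPoly W ↔ p ∈ Algebra.adjoin ℝ (Set.range P)
  top : Fin t → Fin ℓ
  htop : ∀ i, blk (top i) = i
  htopdeg : ∀ i c, blk c = i → c ≠ top i → deg c < deg (top i)

/-! ### Primitive derivations and the connection `∇_D`. -/

/-- The covariant derivative `∇_D` on rational 1-forms: since `∇_D (dx_x) = 0`,
it acts componentwise, `∇_D(Σ f_x dx_x) = Σ D(f_x) dx_x`. -/
def nabVec (D : Derivation ℝ (Ffield ℓ) (Ffield ℓ)) (ω : OmF ℓ) : OmF ℓ :=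
  fun x => D (ω x)

/-- `T = ker (D : R → R)`, viewed inside `F`. -/
def TF (W : Subgroup (Matrix.GeneralLinearGroup (Fin ℓ) ℝ))
    (D : Derivation ℝ (Ffield ℓ) (Ffield ℓ)) : Set (Ffield ℓ) :=
  {y ∈ RF W | D y = 0}

/-- The differential `dP` of a polynomial, as a component vector: `(dP)_x = ∂P/∂x_x`. -/
def dPoly (p : Spoly ℓ) : OmF ℓ := fun x => toF (MvPolynomial.pderiv x p)

/-! ### Freeness of a submodule over a subring of coefficients. -/

/-- `v : ι → M` is a basis of the sub-`C`-module `Mod ⊆ M` over the coefficient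
set `C ⊆ F`: the members of the family lie in `Mod`, every element of `Mod`
is a finite `C`-linear combination of them, and they are linearly independent
over `C`. -/
def IsBasisOver {ℓ : ℕ} {ι M : Type*} [AddCommMonoid M] [Module (Ffield ℓ) M]
    (C : Set (Ffield ℓ)) (Mod : Set M) (v : ι → M) : Prop :=
  (∀ j, v j ∈ Mod) ∧
  (∀ ω ∈ Mod, ∃ c : ι →₀ Ffield ℓ, (∀ j, c j ∈ C) ∧ ω = c.sum fun j a => a • v j) ∧
  (∀ c : ι →₀ Ffield ℓ, (∀ j, c j ∈ C) → (c.sum fun j a => a • v j) = 0 → c = 0)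

/-! ### Order of poles along a hyperplane. -/

/-- The localization `S_{(α)}` of `S` at the prime ideal `(α)`, viewed in `F`:
fractions with denominator prime to `α`. -/
def Sloc (a : Fin ℓ → ℝ) : Set (Ffield ℓ) :=
  {y | ∃ p q : Spoly ℓ, ¬ linForm a ∣ q ∧ y * toF q = toF p}

/-- `ordEq a f k` says `ord_α(f) = k`, i.e. `k = min {j : α^j f ∈ S_{(α)}}`. -/
def ordEq (a : Fin ℓ → ℝ) (f : Ffield ℓ) (k : ℤ) : Prop :=
  linF a ^ k * f ∈ Sloc a ∧ ∀ j : ℤ, linF a ^ j * f ∈ Sloc a → k ≤ j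

/-! ### Logarithmic derivation modules. -/

/-- The module `D(A,−∞)` of logarithmic derivations (Definition 4.1):
`Q^N ξ` regular and `(Q/α_H)^N ξ(β)` regular whenever `β ⊥ α_H`. -/
def DerInf (A : Finset (Fin ℓ → ℝ)) : Set (Derivation ℝ (Ffield ℓ) (Ffield ℓ)) :=
  {ξ | ∃ N : ℕ,
    (∀ x, QF A ^ N * ξ (XF x) ∈ Sreg ℓ) ∧
    ∀ a ∈ A, ∀ b : Fin ℓ → ℝ, (∑ x, a x * b x) = 0 →
      (QF A / linF a) ^ N * ξ (linF b) ∈ Sreg ℓ}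

/-- `D(A,m)` for a multiplicity `m : A → ℤ`:
`(Q/α_H)^N ξ(α_H) ∈ α_H^{m(H)} S` for `N ≫ 0`. -/
def DerMult (A : Finset (Fin ℓ → ℝ)) (m : (Fin ℓ → ℝ) → ℤ) :
    Set (Derivation ℝ (Ffield ℓ) (Ffield ℓ)) :=
  {ξ ∈ DerInf A | ∃ N : ℕ, ∀ a ∈ A, ∃ p : Spoly ℓ,
    (QF A / linF a) ^ N * ξ (linF a) = linF a ^ m a * toF p}

/-- The component vector of a derivation: `ξ = Σ_x ξ(x_x) ∂_x`. -/
def derVec (ξ : Derivation ℝ (Ffield ℓ) (Ffield ℓ)) : OmF ℓ := fun x => ξ (XF x)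

/-- `W`-invariant derivations (via the action on component vectors; the group
consists of orthogonal transformations). -/
def InvDer (W : Subgroup (Matrix.GeneralLinearGroup (Fin ℓ) ℝ)) :
    Set (Derivation ℝ (Ffield ℓ) (Ffield ℓ)) :=
  {ξ | ∀ g ∈ W, vecAct g (derVec ξ) = derVec ξ}

/-- `D(A,−∞)^W`. -/
def DerInfW (A : Finset (Fin ℓ → ℝ)) (W : Subgroup (Matrix.GeneralLinearGroup (Fin ℓ) ℝ)) :
    Set (Derivation ℝ (Ffield ℓ) (Ffield ℓ)) := DerInf A ∩ InvDer W

/-- `D(A,m)^W = D(A,m) ∩ D(A,−∞)^W`. -/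
def DerMultW (A : Finset (Fin ℓ → ℝ)) (W : Subgroup (Matrix.GeneralLinearGroup (Fin ℓ) ℝ))
    (m : (Fin ℓ → ℝ) → ℤ) : Set (Derivation ℝ (Ffield ℓ) (Ffield ℓ)) :=
  DerMult A m ∩ InvDer W

/-- `I* : Ω_F → Der_F`, `I*(ω)(f) = I*(ω, df) = Σ_x ω_x ∂f/∂x_x`, defined using a
family `pd` of partial-derivative derivations of `F`. -/
def IstarDer (pd : Fin ℓ → Derivation ℝ (Ffield ℓ) (Ffield ℓ)) (ω : OmF ℓ) :
    Derivation ℝ (Ffield ℓ) (Ffield ℓ) :=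
  ∑ x, ω x • pd x

/-- The covariant derivative `∇_D` on rational derivations: `(∇_D ξ)(α) = D(ξ(α))`
for `α ∈ V*`, i.e. `∇_D ξ = Σ_x D(ξ(x_x)) ∂_x`. -/
def nabDer (pd : Fin ℓ → Derivation ℝ (Ffield ℓ) (Ffield ℓ))
    (D : Derivation ℝ (Ffield ℓ) (Ffield ℓ))
    (ξ : Derivation ℝ (Ffield ℓ) (Ffield ℓ)) : Derivation ℝ (Ffield ℓ) (Ffield ℓ) :=
  ∑ x, D (ξ (XF x)) • pd x

end CoxeterFormalization

section Statements

variable {ℓ t : ℕ}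

/-- The primitive filtration `P^{(m)}_k = ∇_D^k Ω(A,m)^W`, where the `T`-linear
automorphism of `Ω(A,∞)^W` induced by `∇_D` is recorded as a permutation `e`
(so that `∇_D^k` makes sense for all `k ∈ ℤ`). -/
def PFilt {A : Finset (Fin ℓ → ℝ)} {W : Subgroup (Matrix.GeneralLinearGroup (Fin ℓ) ℝ)}
    (e : Equiv.Perm {ω : OmF ℓ // ω ∈ OmegaInfW A W}) (m : (Fin ℓ → ℝ) → ℤ) (k : ℤ) :
    Set (OmF ℓ) :=
  Subtype.val '' ((e ^ k) '' {w : {ω : OmF ℓ // ω ∈ OmegaInfW A W} | (w : OmF ℓ) ∈ OmegaMult A m})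

/-! ### Elementary facts on linear forms -/

section LinearForms

@[simp] lemma toF_mul (p q : Spoly ℓ) : toF (p * q) = toF p * toF q := map_mul _ p q
@[simp] lemma toF_add (p q : Spoly ℓ) : toF (p + q) = toF p + toF q := map_add _ p q
@[simp] lemma toF_sub (p q : Spoly ℓ) : toF (p - q) = toF p - toF q := map_sub _ p q
@[simp] lemma toF_neg (p : Spoly ℓ) : toF (-p) = -toF p := map_neg _ p
@[simp] lemma toF_pow (p : Spoly ℓ) (n : ℕ) : toF (p ^ n) = toF p ^ n := map_pow _ p n
@[simp] lemma toF_zero : toF (0 : Spoly ℓ) = 0 := map_zero _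
@[simp] lemma toF_one : toF (1 : Spoly ℓ) = 1 := map_one _
@[simp] lemma toF_sum {ι : Type*} (s : Finset ι) (f : ι → Spoly ℓ) :
    toF (∑ i ∈ s, f i) = ∑ i ∈ s, toF (f i) := map_sum _ f s

lemma toF_injective : Function.Injective (toF : Spoly ℓ → Ffield ℓ) :=
  IsFractionRing.injective (Spoly ℓ) (Ffield ℓ)

@[simp] lemma toF_eq_zero {p : Spoly ℓ} : toF p = 0 ↔ p = 0 := by
  rw [← toF_zero, toF_injective.eq_iff]

lemma cF_eq_algebraMap (r : ℝ) : (cF r : Ffield ℓ) = algebraMap ℝ (Ffield ℓ) r := by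
  rw [IsScalarTower.algebraMap_apply ℝ (Spoly ℓ) (Ffield ℓ)]; rfl

lemma coeff_linForm (a : Fin ℓ → ℝ) (x : Fin ℓ) :
    coeff (Finsupp.single x 1) (linForm a) = a x := by
  classical
  simp [linForm, coeff_sum, coeff_C_mul, coeff_X, Finsupp.single_left_inj]

lemma linForm_smul (c : ℝ) (a : Fin ℓ → ℝ) : linForm (c • a) = C c * linForm a := by
  simp [linForm, Finset.mul_sum, mul_assoc]

lemma linForm_sub (a b : Fin ℓ → ℝ) : linForm (a - b) = linForm a - linForm b := by
  simp [linForm, sub_mul, Finset.sum_sub_distrib]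

lemma linForm_injective : Function.Injective (linForm : (Fin ℓ → ℝ) → Spoly ℓ) := by
  intro a b h
  ext x
  rw [← coeff_linForm a, ← coeff_linForm b, h]

lemma linForm_single (x : Fin ℓ) : linForm (Pi.single x 1) = X x := by
  classical
  simp [linForm, Pi.single_apply, apply_ite C, ite_mul]

lemma linForm_ne_zero {a : Fin ℓ → ℝ} (ha : a ≠ 0) : linForm a ≠ 0 := by
  intro h
  apply ha
  apply linForm_injective
  rw [h]; simp [linForm]

lemma linF_ne_zero {a : Fin ℓ → ℝ} (ha : a ≠ 0) : linF a ≠ 0 :=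
  fun h => linForm_ne_zero ha (toF_eq_zero.1 h)

lemma linForm_isHomogeneous (a : Fin ℓ → ℝ) : (linForm a).IsHomogeneous 1 :=
  IsHomogeneous.sum _ _ _ fun x _ => by
    simpa using (isHomogeneous_C (Fin ℓ) (a x)).mul (isHomogeneous_X ℝ x)

lemma prime_linForm {a : Fin ℓ → ℝ} (ha : a ≠ 0) : Prime (linForm a) := by
  rw [← UniqueFactorizationMonoid.irreducible_iff_prime]
  apply irreducible_of_totalDegree_eq_one
  · exact (linForm_isHomogeneous a).totalDegree (linForm_ne_zero ha)
  · intro r hr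
    obtain ⟨x, hx⟩ := Function.ne_iff.1 ha
    have := hr (Finsupp.single x 1)
    rw [coeff_linForm] at this
    rw [isUnit_iff_ne_zero]
    rintro rfl
    exact hx (zero_dvd_iff.1 this)

lemma exists_smul_of_linForm_dvd {a b : Fin ℓ → ℝ} (ha : a ≠ 0) (h : linForm a ∣ linForm b) :
    ∃ c : ℝ, b = c • a := by
  by_cases hb : b = 0
  · exact ⟨0, by simp [hb]⟩
  obtain ⟨q, hq⟩ := h
  have hq0 : q ≠ 0 := by
    rintro rfl
    exact linForm_ne_zero hb (by simpa using hq)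
  have h1 := totalDegree_mul_of_isDomain (linForm_ne_zero ha) hq0
  rw [← hq, (linForm_isHomogeneous a).totalDegree (linForm_ne_zero ha),
    (linForm_isHomogeneous b).totalDegree (linForm_ne_zero hb)] at h1
  have h2 : q = C (coeff 0 q) := totalDegree_eq_zero_iff_eq_C.1 (by lia)
  refine ⟨coeff 0 q, linForm_injective ?_⟩
  rw [linForm_smul, hq, mul_comm, ← h2]

lemma matSub_linForm (M : Matrix (Fin ℓ) (Fin ℓ) ℝ) (a : Fin ℓ → ℝ) :
    matSub M (linForm a) = linForm (M.transpose.mulVec a) := by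
  simp only [linForm, map_sum, map_mul, matSub, aeval_X, Matrix.mulVec, dotProduct, Finset.sum_mul,
    Finset.mul_sum, Matrix.transpose_apply]
  rw [Finset.sum_comm]
  refine Finset.sum_congr rfl fun x _ => Finset.sum_congr rfl fun y _ => ?_
  rw [algHom_C, algebraMap_eq]; ring

lemma matSub_X (M : Matrix (Fin ℓ) (Fin ℓ) ℝ) (x : Fin ℓ) :
    matSub M (X x) = linForm (M x) := by
  simp [matSub, linForm]

lemma reflMat_mulVec (a v : Fin ℓ → ℝ) :
    (reflMat a).mulVec v = v - (2 / (a ⬝ᵥ a) * (a ⬝ᵥ v)) • a := by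
  rw [reflMat, Matrix.sub_mulVec, Matrix.one_mulVec, Matrix.smul_mulVec, Matrix.vecMulVec_mulVec]
  ext x
  simp [dotProduct]; ring

lemma reflMat_transpose (a : Fin ℓ → ℝ) : (reflMat a).transpose = reflMat a := by
  ext x y
  simp [reflMat, Matrix.vecMulVec_apply, Matrix.one_apply, eq_comm, mul_comm]

lemma reflMat_mulVec_self {a : Fin ℓ → ℝ} (ha : a ≠ 0) : (reflMat a).mulVec a = -a := by
  rw [reflMat_mulVec, div_mul_cancel₀]
  · ext x; simp; ring
  · simpa using ha

lemma reflMat_mulVec_of_orthogonal {a v : Fin ℓ → ℝ} (h : a ⬝ᵥ v = 0) :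
    (reflMat a).mulVec v = v := by
  rw [reflMat_mulVec, h]; simp

lemma linForm_dvd_sub_matSub_reflMat (a : Fin ℓ → ℝ) (p : Spoly ℓ) :
    linForm a ∣ p - matSub (reflMat a) p := by
  induction p using MvPolynomial.induction_on with
  | C r => simp [matSub]
  | add p q hp hq =>
    rw [map_add]
    convert dvd_add hp hq using 1; ring
  | mul_X p x hp =>
    have hx : linForm a ∣ X x - matSub (reflMat a) (X x) := by
      rw [← linForm_single, matSub_linForm, reflMat_transpose, ← linForm_sub, reflMat_mulVec,
        sub_sub_cancel, linForm_smul]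
      exact dvd_mul_left _ _
    rw [map_mul]
    have : p * X x - matSub (reflMat a) p * matSub (reflMat a) (X x) =
      (p - matSub (reflMat a) p) * X x +
        matSub (reflMat a) p * (X x - matSub (reflMat a) (X x)) := by
      ring
    rw [this]
    exact dvd_add (hp.mul_right _) (hx.mul_left _)

end LinearForms

/-! ### The local ring along a hyperplane -/

section LocalRing

lemma toF_mem_Sloc {a : Fin ℓ → ℝ} (ha : a ≠ 0) (p : Spoly ℓ) : toF p ∈ Sloc a :=
  ⟨p, 1, (prime_linForm ha).not_dvd_one, by simp⟩

/-- `Sloc a` as a subring of the field of rational functions. -/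
def slocSubring {a : Fin ℓ → ℝ} (ha : a ≠ 0) : Subring (Ffield ℓ) where
  carrier := Sloc a
  mul_mem' := by
    rintro y z ⟨p, q, hq, h⟩ ⟨p', q', hq', h'⟩
    refine ⟨p * p', q * q', (prime_linForm ha).not_dvd_mul hq hq', ?_⟩
    rw [toF_mul, toF_mul, ← h, ← h']; ring
  one_mem' := by simpa using toF_mem_Sloc ha 1
  add_mem' := by
    rintro y z ⟨p, q, hq, h⟩ ⟨p', q', hq', h'⟩
    refine ⟨p * q' + p' * q, q * q', (prime_linForm ha).not_dvd_mul hq hq', ?_⟩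
    rw [toF_add, toF_mul, toF_mul, toF_mul, ← h, ← h']; ring
  zero_mem' := by simpa using toF_mem_Sloc ha 0
  neg_mem' := by
    rintro y ⟨p, q, hq, h⟩
    exact ⟨-p, q, hq, by rw [toF_neg, ← h]; ring⟩

variable {a : Fin ℓ → ℝ}

lemma Sloc_mul (ha : a ≠ 0) {y z : Ffield ℓ} (hy : y ∈ Sloc a) (hz : z ∈ Sloc a) :
    y * z ∈ Sloc a := (slocSubring ha).mul_mem hy hz

lemma Sloc_add (ha : a ≠ 0) {y z : Ffield ℓ} (hy : y ∈ Sloc a) (hz : z ∈ Sloc a) :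
    y + z ∈ Sloc a := (slocSubring ha).add_mem hy hz

lemma Sloc_sub (ha : a ≠ 0) {y z : Ffield ℓ} (hy : y ∈ Sloc a) (hz : z ∈ Sloc a) :
    y - z ∈ Sloc a := (slocSubring ha).sub_mem hy hz

lemma Sloc_sum (ha : a ≠ 0) {ι : Type*} {s : Finset ι} {f : ι → Ffield ℓ}
    (h : ∀ i ∈ s, f i ∈ Sloc a) : ∑ i ∈ s, f i ∈ Sloc a := (slocSubring ha).sum_mem h

lemma toF_ne_zero_of_not_dvd {q : Spoly ℓ} (hq : ¬ linForm a ∣ q) : toF q ≠ 0 := by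
  rintro h
  exact hq (by rw [toF_eq_zero.1 h]; exact dvd_zero _)

lemma inv_toF_mem_Sloc {q : Spoly ℓ} (hq : ¬ linForm a ∣ q) : (toF q)⁻¹ ∈ Sloc a :=
  ⟨1, q, hq, by rw [inv_mul_cancel₀ (toF_ne_zero_of_not_dvd hq), toF_one]⟩

lemma linF_zpow_mem_Sloc (ha : a ≠ 0) {n : ℤ} (hn : 0 ≤ n) : linF a ^ n ∈ Sloc a := by
  obtain ⟨k, rfl⟩ := Int.eq_ofNat_of_zero_le hn
  rw [zpow_natCast]
  exact (slocSubring ha).pow_mem (toF_mem_Sloc ha _) k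

lemma linF_zpow_mul_mem_mono (ha : a ≠ 0) {n k : ℤ} (hnk : n ≤ k) {f : Ffield ℓ}
    (h : linF a ^ n * f ∈ Sloc a) : linF a ^ k * f ∈ Sloc a := by
  have := Sloc_mul ha (linF_zpow_mem_Sloc ha (sub_nonneg.2 hnk)) h
  rwa [← mul_assoc, ← zpow_add₀ (linF_ne_zero ha), sub_add_cancel] at this

lemma linF_inv_mul_mem_Sloc_or (ha : a ≠ 0) {y z : Ffield ℓ} (hy : y ∈ Sloc a) (hz : z ∈ Sloc a)
    (h : (linF a)⁻¹ * (y * z) ∈ Sloc a) : (linF a)⁻¹ * y ∈ Sloc a ∨ (linF a)⁻¹ * z ∈ Sloc a := by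
  obtain ⟨p, q, hq, hy⟩ := hy
  obtain ⟨p', q', hq', hz⟩ := hz
  obtain ⟨r, u, hu, h⟩ := h
  have h0 := linF_ne_zero ha
  have hp := prime_linForm ha
  have key : ∀ {w : Ffield ℓ} {p q : Spoly ℓ}, ¬ linForm a ∣ q → w * toF q = toF p →
      linForm a ∣ p → (linF a)⁻¹ * w ∈ Sloc a := by
    rintro w p q hq h ⟨v, rfl⟩
    refine ⟨v, q, hq, ?_⟩
    rw [mul_assoc, h, toF_mul]
    exact inv_mul_cancel_left₀ h0 _
  have h1 : p * p' * u = linForm a * (r * q * q') := by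
    apply toF_injective
    simp only [toF_mul, ← hy, ← hz, ← h]
    change _ = linF a * _
    field_simp
  have h2 : linForm a ∣ p * p' :=
    (hp.dvd_or_dvd (h1 ▸ dvd_mul_right _ _)).resolve_right hu
  exact (hp.dvd_or_dvd h2).imp (key hq hy) (key hq' hz)

lemma linF_inv_notMem_Sloc (ha : a ≠ 0) : (linF a)⁻¹ ∉ Sloc a := by
  rintro ⟨p, q, hq, h⟩
  apply hq
  refine ⟨p, toF_injective ?_⟩
  rw [toF_mul, ← h]
  exact (mul_inv_cancel_left₀ (linF_ne_zero ha) _).symm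

lemma toF_mem_Sreg (p : Spoly ℓ) : toF p ∈ Sreg ℓ := ⟨p, rfl⟩

lemma Sreg_mul {y z : Ffield ℓ} (hy : y ∈ Sreg ℓ) (hz : z ∈ Sreg ℓ) : y * z ∈ Sreg ℓ :=
  (algebraMap (Spoly ℓ) (Ffield ℓ)).range.mul_mem hy hz

lemma Sreg_sum {ι : Type*} {s : Finset ι} {f : ι → Ffield ℓ}
    (h : ∀ i ∈ s, f i ∈ Sreg ℓ) : ∑ i ∈ s, f i ∈ Sreg ℓ :=
  (algebraMap (Spoly ℓ) (Ffield ℓ)).range.sum_mem h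

lemma Sreg_subset_Sloc (ha : a ≠ 0) {y : Ffield ℓ} (hy : y ∈ Sreg ℓ) : y ∈ Sloc a := by
  obtain ⟨p, rfl⟩ := hy
  exact toF_mem_Sloc ha p

lemma mem_Sreg_of_linF_pow_mul (ha : a ≠ 0) {z : Ffield ℓ} {n : ℕ} (h : linF a ^ n * z ∈ Sreg ℓ)
    (hz : z ∈ Sloc a) : z ∈ Sreg ℓ := by
  obtain ⟨s, hs⟩ := h
  obtain ⟨p, q, hq, hz⟩ := hz
  change toF s = _ at hs
  have h1 : q * s = linForm a ^ n * p := by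
    apply toF_injective
    rw [toF_mul, toF_mul, toF_pow, hs, ← hz]
    change _ = linF a ^ n * _
    ring
  obtain ⟨v, rfl⟩ := (prime_linForm ha).pow_dvd_of_dvd_mul_left n hq ⟨p, h1⟩
  refine ⟨v, ?_⟩
  change toF v = z
  rw [toF_mul, toF_pow] at hs
  exact mul_left_cancel₀ (pow_ne_zero n (linF_ne_zero ha)) hs

lemma mem_Sreg_of_forall_mem_Sloc (A : Finset (Fin ℓ → ℝ)) (hA : ∀ a ∈ A, a ≠ 0) {N : ℕ}
    {z : Ffield ℓ} (h : QF A ^ N * z ∈ Sreg ℓ) (hz : ∀ a ∈ A, z ∈ Sloc a) : z ∈ Sreg ℓ := by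
  classical
  induction A using Finset.induction_on with
  | empty => simpa [QF] using h
  | insert b B hb ih =>
    refine ih (fun a ha => hA a (Finset.mem_insert_of_mem ha)) ?_
      fun a ha => hz a (Finset.mem_insert_of_mem ha)
    have hb0 := hA b (Finset.mem_insert_self b B)
    refine mem_Sreg_of_linF_pow_mul hb0 (n := N) ?_
      (Sloc_mul hb0 ?_ (hz b (Finset.mem_insert_self b B)))
    · convert h using 1
      rw [QF, QF, Finset.prod_insert hb, toF_mul, mul_pow, mul_assoc]
      rfl
    · rw [QF, ← toF_pow]
      exact toF_mem_Sloc hb0 _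

end LocalRing

/-! ### Parity with respect to a reflection -/

section Parity

@[simp] lemma fAct_toF (g : Matrix.GeneralLinearGroup (Fin ℓ) ℝ) (p : Spoly ℓ) :
    fAct g (toF p) = toF (matSub (↑g⁻¹ : Matrix (Fin ℓ) (Fin ℓ) ℝ) p) :=
  IsFractionRing.lift_algebraMap _ p

@[simp] lemma fAct_cF (g : Matrix.GeneralLinearGroup (Fin ℓ) ℝ) (r : ℝ) :
    fAct g (cF r) = cF r := by
  rw [cF, fAct_toF, matSub, algHom_C]; rfl

variable {a : Fin ℓ → ℝ} {g : Matrix.GeneralLinearGroup (Fin ℓ) ℝ}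

lemma reflMat_mul_self (ha : a ≠ 0) : reflMat a * reflMat a = 1 := by
  have haa : a ⬝ᵥ a ≠ 0 := by simpa using ha
  apply Matrix.toLin'.injective
  ext1 v
  ext1
  simp only [Matrix.toLin'_mul, LinearMap.comp_apply, Matrix.toLin'_apply, Matrix.toLin'_one]
  rw [reflMat_mulVec, reflMat_mulVec]
  simp only [dotProduct_sub, dotProduct_smul, smul_eq_mul, LinearMap.single_apply,
    LinearMap.id_apply]
  rw [sub_sub, ← add_smul]
  convert sub_zero _ using 2
  convert zero_smul ℝ a using 2
  field_simp
  ring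

lemma coe_inv_eq_reflMat (ha : a ≠ 0) (hg : (g : Matrix (Fin ℓ) (Fin ℓ) ℝ) = reflMat a) :
    (↑g⁻¹ : Matrix (Fin ℓ) (Fin ℓ) ℝ) = reflMat a := by
  have : g * g = 1 := Units.ext (by rw [Units.val_mul, hg, reflMat_mul_self ha]; rfl)
  rw [inv_eq_of_mul_eq_one_right this, hg]

lemma matSub_reflMat_involutive (ha : a ≠ 0) (p : Spoly ℓ) :
    matSub (reflMat a) (matSub (reflMat a) p) = p := by
  rw [← AlgHom.comp_apply, matSub_comp, reflMat_mul_self ha, matSub_one, AlgHom.id_apply]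

lemma fAct_reflMat_toF (ha : a ≠ 0) (hg : (g : Matrix (Fin ℓ) (Fin ℓ) ℝ) = reflMat a)
    (p : Spoly ℓ) : fAct g (toF p) = toF (matSub (reflMat a) p) := by
  rw [fAct_toF, coe_inv_eq_reflMat ha hg]

lemma fAct_reflMat_linF (ha : a ≠ 0) (hg : (g : Matrix (Fin ℓ) (Fin ℓ) ℝ) = reflMat a) :
    fAct g (linF a) = -linF a := by
  rw [linF, fAct_reflMat_toF ha hg, matSub_linForm, reflMat_transpose, reflMat_mulVec_self ha,
    ← toF_neg, ← neg_one_smul ℝ a, linForm_smul]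
  simp

lemma toF_C_half_mul_two : (toF (C (1 / 2)) : Ffield ℓ) * 2 = 1 := by
  have : (2 : Ffield ℓ) = toF (C 2) := by
    rw [← cF, cF_eq_algebraMap]
    exact (map_ofNat (algebraMap ℝ (Ffield ℓ)) 2).symm
  rw [this, ← toF_mul, ← C_mul]; norm_num

lemma not_dvd_matSub_reflMat {q : Spoly ℓ} (hq : ¬ linForm a ∣ q) :
    ¬ linForm a ∣ matSub (reflMat a) q := fun h =>
  hq (by simpa using dvd_add (linForm_dvd_sub_matSub_reflMat a q) h)

lemma linF_inv_mul_mem_Sloc_of_odd (ha : a ≠ 0)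
    (hg : (g : Matrix (Fin ℓ) (Fin ℓ) ℝ) = reflMat a) {w : Ffield ℓ} (hw : w ∈ Sloc a)
    (hodd : fAct g w = -w) : (linF a)⁻¹ * w ∈ Sloc a := by
  obtain ⟨p, q, hq, h⟩ := hw
  have h' := congrArg (fAct g) h
  rw [map_mul, hodd, fAct_reflMat_toF ha hg, fAct_reflMat_toF ha hg] at h'
  set p' := matSub (reflMat a) p
  set q' := matSub (reflMat a) q
  have hd : linForm a ∣ (p - p') * q' - (q - q') * p' :=
    dvd_sub ((linForm_dvd_sub_matSub_reflMat a p).mul_right _)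
      ((linForm_dvd_sub_matSub_reflMat a q).mul_right _)
  obtain ⟨r, hr⟩ := hd
  refine ⟨C (1 / 2) * r, q * q',
    (prime_linForm ha).not_dvd_mul hq (not_dvd_matSub_reflMat hq), ?_⟩
  have hr' := congrArg toF hr
  simp only [toF_mul, toF_sub, ← h, ← h'] at hr'
  change _ = linF a * _ at hr'
  have h0 := linF_ne_zero ha
  have h2 := toF_C_half_mul_two (ℓ := ℓ)
  rw [toF_mul, toF_mul]
  apply mul_left_cancel₀ h0
  linear_combination toF (C (1 / 2)) * hr' - (w * toF q * toF q') * h2 +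
    (mul_inv_cancel₀ h0) * w * toF q * toF q'

lemma exists_even_fraction (ha : a ≠ 0)
    (hg : (g : Matrix (Fin ℓ) (Fin ℓ) ℝ) = reflMat a) {w : Ffield ℓ} (hw : w ∈ Sloc a)
    (heven : fAct g w = w) : ∃ p q : Spoly ℓ, matSub (reflMat a) p = p ∧ matSub (reflMat a) q = q ∧
      ¬ linForm a ∣ q ∧ w * toF q = toF p := by
  obtain ⟨p, q, hq, h⟩ := hw
  have h' := congrArg (fAct g) h
  rw [map_mul, heven, fAct_reflMat_toF ha hg, fAct_reflMat_toF ha hg] at h'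
  refine ⟨p * matSub (reflMat a) q, q * matSub (reflMat a) q, ?_, ?_,
    (prime_linForm ha).not_dvd_mul hq (not_dvd_matSub_reflMat hq), ?_⟩
  · apply toF_injective
    rw [map_mul, matSub_reflMat_involutive ha, toF_mul, toF_mul, ← h, ← h']
    ring
  · rw [map_mul, matSub_reflMat_involutive ha, mul_comm]
  · rw [toF_mul, toF_mul, ← h]; ring

lemma fAct_linF_zpow_mul_of_odd (ha : a ≠ 0) (hg : (g : Matrix (Fin ℓ) (Fin ℓ) ℝ) = reflMat a)
    {f : Ffield ℓ} (hf : fAct g f = -f) (n : ℤ) :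
    fAct g (linF a ^ n * f) = -(-1) ^ n * (linF a ^ n * f) := by
  rw [map_mul, map_zpow₀, fAct_reflMat_linF ha hg, hf, ← neg_one_mul (linF a), mul_zpow]
  ring

lemma linF_zpow_pred_mul_mem_of_even (ha : a ≠ 0)
    (hg : (g : Matrix (Fin ℓ) (Fin ℓ) ℝ) = reflMat a) {f : Ffield ℓ} (hf : fAct g f = -f) {n : ℤ}
    (hn : Even n) (h : linF a ^ n * f ∈ Sloc a) : linF a ^ (n - 1) * f ∈ Sloc a := by
  have := linF_inv_mul_mem_Sloc_of_odd ha hg h (by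
    rw [fAct_linF_zpow_mul_of_odd ha hg hf, hn.neg_one_zpow]; ring)
  rwa [← mul_assoc, ← zpow_neg_one, ← zpow_add₀ (linF_ne_zero ha), neg_add_eq_sub] at this

variable {D : Derivation ℝ (Ffield ℓ) (Ffield ℓ)}

lemma derivation_mem_Sloc_of_even (ha : a ≠ 0)
    (hg : (g : Matrix (Fin ℓ) (Fin ℓ) ℝ) = reflMat a)
    (hD : ∀ y : Spoly ℓ, matSub (reflMat a) y = y → D (toF y) ∈ Sloc a)
    {w : Ffield ℓ} (hw : w ∈ Sloc a) (heven : fAct g w = w) : D w ∈ Sloc a := by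
  obtain ⟨p, q, hp, hq, hd, h⟩ := exists_even_fraction ha hg hw heven
  have h1 := congrArg D h
  rw [Derivation.leibniz, smul_eq_mul, smul_eq_mul] at h1
  have h2 : D w = (toF q)⁻¹ * (D (toF p) - w * D (toF q)) := by
    have := toF_ne_zero_of_not_dvd hd
    rw [← h1]
    field_simp
    ring
  rw [h2]
  exact Sloc_mul ha (inv_toF_mem_Sloc hd) (Sloc_sub ha (hD p hp) (Sloc_mul ha hw (hD q hq)))

lemma linF_mul_derivation_linF_mem_Sloc (ha : a ≠ 0)
    (hD : ∀ y : Spoly ℓ, matSub (reflMat a) y = y → D (toF y) ∈ Sloc a) :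
    linF a * D (linF a) ∈ Sloc a := by
  have h := hD (linForm a * linForm a) (by
    rw [map_mul, matSub_linForm, reflMat_transpose, reflMat_mulVec_self ha, ← neg_one_smul ℝ a,
      linForm_smul]
    simp)
  rw [toF_mul, Derivation.leibniz, smul_eq_mul] at h
  have := Sloc_mul ha (toF_mem_Sloc ha (C (1 / 2))) h
  convert this using 1
  have h2 := toF_C_half_mul_two (ℓ := ℓ)
  rw [← two_mul, ← mul_assoc, h2, one_mul]
  rfl

lemma derivation_of_odd_expansion (ha : a ≠ 0) (f : Ffield ℓ) (n : ℤ) :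
    linF a ^ (n + 2) * D f = -(n : Ffield ℓ) * (linF a * D (linF a)) * (linF a ^ n * f) +
      linF a ^ (2 : ℤ) * D (linF a ^ n * f) := by
  have h0 := linF_ne_zero ha
  rw [Derivation.leibniz, Derivation.leibniz_zpow]
  simp only [smul_eq_mul, zsmul_eq_mul]
  rw [zpow_sub_one₀ h0, zpow_add₀ h0]
  field_simp
  ring

lemma derivation_order_le (ha : a ≠ 0)
    (hg : (g : Matrix (Fin ℓ) (Fin ℓ) ℝ) = reflMat a)
    (hD : ∀ y : Spoly ℓ, matSub (reflMat a) y = y → D (toF y) ∈ Sloc a)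
    {f : Ffield ℓ} (hf : fAct g f = -f) {n : ℤ} (h : linF a ^ n * f ∈ Sloc a) :
    linF a ^ (n + 2) * D f ∈ Sloc a := by
  have odd_case : ∀ n : ℤ, Odd n → linF a ^ n * f ∈ Sloc a → linF a ^ (n + 2) * D f ∈ Sloc a := by
    intro n hn h
    rw [derivation_of_odd_expansion ha]
    refine Sloc_add ha (Sloc_mul ha (Sloc_mul ha ?_ (linF_mul_derivation_linF_mem_Sloc ha hD)) h)
      (Sloc_mul ha (linF_zpow_mem_Sloc ha (by norm_num)) ?_)
    · exact (slocSubring ha).neg_mem (intCast_mem (slocSubring ha) n)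
    · refine derivation_mem_Sloc_of_even ha hg hD h ?_
      rw [fAct_linF_zpow_mul_of_odd ha hg hf, hn.neg_one_zpow]; ring
  rcases Int.even_or_odd n with hn | hn
  · have h1 := odd_case (n - 1) (hn.sub_odd odd_one) (linF_zpow_pred_mul_mem_of_even ha hg hf hn h)
    exact linF_zpow_mul_mem_mono ha (by lia) h1
  · exact odd_case n hn h

lemma order_descent (ha : a ≠ 0)
    (hg : (g : Matrix (Fin ℓ) (Fin ℓ) ℝ) = reflMat a)
    (hD : ∀ y : Spoly ℓ, matSub (reflMat a) y = y → D (toF y) ∈ Sloc a)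
    (hpole : D (linF a) ∉ Sloc a) {f : Ffield ℓ} (hf : fAct g f = -f) {k : ℤ}
    (h : linF a ^ k * f ∈ Sloc a) (h' : linF a ^ (k + 1) * D f ∈ Sloc a) :
    linF a ^ (k - 1) * f ∈ Sloc a := by
  have h0 := linF_ne_zero ha
  rcases Int.even_or_odd k with hk | hk
  · exact linF_zpow_pred_mul_mem_of_even ha hg hf hk h
  have hk0 : (k : ℝ) ≠ 0 := by
    intro h; simp only [Int.cast_eq_zero] at h; subst h; simp at hk
  have hw : D (linF a ^ k * f) ∈ Sloc a := derivation_mem_Sloc_of_even ha hg hD h (by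
    rw [fAct_linF_zpow_mul_of_odd ha hg hf, hk.neg_one_zpow]; ring)
  have key : (linF a)⁻¹ * ((linF a * D (linF a)) * (linF a ^ k * f)) ∈ Sloc a := by
    have h1 : (linF a)⁻¹ * ((linF a * D (linF a)) * (linF a ^ k * f)) =
        toF (C (1 / (k : ℝ))) * (linF a * D (linF a ^ k * f) - linF a ^ (k + 1) * D f) := by
      have h2 : (toF (C (1 / (k : ℝ))) : Ffield ℓ) * k = 1 := by
        have : (k : Ffield ℓ) = toF (C (k : ℝ)) := by
          rw [← cF, cF_eq_algebraMap]; simp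
        rw [this, ← toF_mul, ← C_mul, one_div, inv_mul_cancel₀ hk0]; simp
      have h3 := derivation_of_odd_expansion (D := D) ha f k
      have h4 : linF a ^ (k + 2) * D f = linF a * (linF a ^ (k + 1) * D f) := by
        rw [← mul_assoc, ← zpow_one_add₀ h0]; ring_nf
      rw [h4, zpow_ofNat] at h3
      apply mul_left_cancel₀ h0
      rw [mul_inv_cancel_left₀ h0]
      linear_combination (-(linF a * D (linF a)) * (linF a ^ k * f)) * h2 +
        toF (C (1 / (k : ℝ))) * h3
    rw [h1]
    exact Sloc_mul ha (toF_mem_Sloc ha _)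
      (Sloc_sub ha (Sloc_mul ha (toF_mem_Sloc ha _) hw) h')
  rcases linF_inv_mul_mem_Sloc_or ha (linF_mul_derivation_linF_mem_Sloc ha hD) h key with h1 | h1
  · rw [inv_mul_cancel_left₀ h0] at h1
    exact absurd h1 hpole
  · rwa [← mul_assoc, ← zpow_neg_one, ← zpow_add₀ h0, neg_add_eq_sub] at h1

lemma order_le_of_derivation_order_le (ha : a ≠ 0)
    (hg : (g : Matrix (Fin ℓ) (Fin ℓ) ℝ) = reflMat a)
    (hD : ∀ y : Spoly ℓ, matSub (reflMat a) y = y → D (toF y) ∈ Sloc a)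
    (hpole : D (linF a) ∉ Sloc a) {f : Ffield ℓ} (hf : fAct g f = -f) {n N : ℤ}
    (hN : linF a ^ N * f ∈ Sloc a) (h' : linF a ^ (n + 2) * D f ∈ Sloc a) :
    linF a ^ n * f ∈ Sloc a := by
  have key : ∀ j : ℕ, linF a ^ (n + j) * f ∈ Sloc a → linF a ^ n * f ∈ Sloc a := by
    intro j
    induction j with
    | zero => simp
    | succ j ih =>
      intro hj
      apply ih
      have := order_descent ha hg hD hpole hf hj (linF_zpow_mul_mem_mono ha (by push_cast; lia) h')
      convert this using 3
      push_cast; ring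
  rcases le_total N n with hNn | hNn
  · exact linF_zpow_mul_mem_mono ha hNn hN
  · apply key (N - n).toNat
    rwa [Int.toNat_of_nonneg (by lia), add_sub_cancel]

end Parity

/-! ### Derivations and orbit polynomials -/

section OrbitPolynomial

variable {W : Subgroup (Matrix.GeneralLinearGroup (Fin ℓ) ℝ)}
  (hW : (W : Set (Matrix.GeneralLinearGroup (Fin ℓ) ℝ)).Finite)

lemma matSub_matSub (g h : Matrix.GeneralLinearGroup (Fin ℓ) ℝ) (p : Spoly ℓ) :
    matSub (h : Matrix (Fin ℓ) (Fin ℓ) ℝ) (matSub (g : Matrix (Fin ℓ) (Fin ℓ) ℝ) p) =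
      matSub ((g * h : Matrix.GeneralLinearGroup (Fin ℓ) ℝ) : Matrix (Fin ℓ) (Fin ℓ) ℝ) p := by
  rw [← AlgHom.comp_apply, matSub_comp, Units.val_mul]

open Classical in
/-- The orbit of a polynomial under a finite group. -/
noncomputable def orbFinset (u : Spoly ℓ) : Finset (Spoly ℓ) :=
  hW.toFinset.image fun g : Matrix.GeneralLinearGroup (Fin ℓ) ℝ =>
    matSub (g : Matrix (Fin ℓ) (Fin ℓ) ℝ) u

open Classical in
/-- `∏ (T - v)` over the members `v ≠ w` of the orbit of `u`. -/
noncomputable def orbProd (u w : Spoly ℓ) : Polynomial (Spoly ℓ) :=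
  ∏ v ∈ (orbFinset hW u).erase w, (Polynomial.X - Polynomial.C v)

/-- The (unnormalized) Lagrange interpolation polynomial taking the orbit of `u` to that of `y`. -/
noncomputable def orbInterp (u y : Spoly ℓ) : Polynomial (Spoly ℓ) :=
  ∑ g ∈ hW.toFinset, Polynomial.C (matSub (g : Matrix (Fin ℓ) (Fin ℓ) ℝ) y) *
    orbProd hW u (matSub (g : Matrix (Fin ℓ) (Fin ℓ) ℝ) u)

open Classical in
lemma image_orbFinset (u : Spoly ℓ) {h : Matrix.GeneralLinearGroup (Fin ℓ) ℝ} (hh : h ∈ W) :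
    (orbFinset hW u).image (matSub (h : Matrix (Fin ℓ) (Fin ℓ) ℝ)) = orbFinset hW u := by
  ext v
  simp only [orbFinset, Finset.mem_image, Set.Finite.mem_toFinset, SetLike.mem_coe,
    exists_exists_and_eq_and, matSub_matSub]
  constructor
  · rintro ⟨g, hg, rfl⟩
    exact ⟨g * h, W.mul_mem hg hh, rfl⟩
  · rintro ⟨g, hg, rfl⟩
    exact ⟨g * h⁻¹, W.mul_mem hg (W.inv_mem hh), by rw [inv_mul_cancel_right]⟩

lemma map_orbProd (u w : Spoly ℓ) {h : Matrix.GeneralLinearGroup (Fin ℓ) ℝ} (hh : h ∈ W) :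
    (orbProd hW u w).map (matSub (h : Matrix (Fin ℓ) (Fin ℓ) ℝ)).toRingHom =
      orbProd hW u (matSub (h : Matrix (Fin ℓ) (Fin ℓ) ℝ) w) := by
  classical
  rw [orbProd, orbProd, Polynomial.map_prod]
  nth_rewrite 2 [← image_orbFinset hW u hh]
  rw [← Finset.image_erase (matSub_injective h), Finset.prod_image (matSub_injective h).injOn]
  simp

lemma map_orbInterp (u y : Spoly ℓ) {h : Matrix.GeneralLinearGroup (Fin ℓ) ℝ} (hh : h ∈ W) :
    (orbInterp hW u y).map (matSub (h : Matrix (Fin ℓ) (Fin ℓ) ℝ)).toRingHom =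
      orbInterp hW u y := by
  rw [orbInterp, Polynomial.map_sum]
  refine Finset.sum_nbij' (fun g => g * h) (fun g => g * h⁻¹) ?_ ?_ ?_ ?_ ?_
  · intro g hg
    simp only [Set.Finite.mem_toFinset, SetLike.mem_coe] at hg ⊢
    exact W.mul_mem hg hh
  · intro g hg
    simp only [Set.Finite.mem_toFinset, SetLike.mem_coe] at hg ⊢
    exact W.mul_mem hg (W.inv_mem hh)
  · intro g _; simp
  · intro g _; simp
  · intro g _
    rw [Polynomial.map_mul, map_orbProd hW _ _ hh, Polynomial.map_C, ← matSub_matSub,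
      ← matSub_matSub]
    rfl

lemma coeff_mem_InvPoly {q : Polynomial (Spoly ℓ)}
    (hq : ∀ h ∈ W, q.map (matSub (h : Matrix (Fin ℓ) (Fin ℓ) ℝ)).toRingHom = q) (k : ℕ) :
    q.coeff k ∈ InvPoly W := by
  intro h hh
  have := congrArg (fun q => Polynomial.coeff q k) (hq h hh)
  simpa using this

variable (δ : Derivation ℝ (Spoly ℓ) (Ffield ℓ)) (I : Submodule (Spoly ℓ) (Ffield ℓ))

lemma derivation_eval_sub_mem (hI : ∀ p ∈ InvPoly W, δ p ∈ I) (u : Spoly ℓ)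
    {q : Polynomial (Spoly ℓ)} (hq : ∀ k, q.coeff k ∈ InvPoly W) :
    δ (q.eval u) - q.derivative.eval u • δ u ∈ I := by
  rw [Polynomial.eval_eq_sum_range, map_sum]
  have h1 : ∀ k ∈ Finset.range (q.natDegree + 1), δ (q.coeff k * u ^ k) =
      u ^ k • δ (q.coeff k) + (q.coeff k * (k * u ^ (k - 1))) • δ u := by
    intro k _
    rw [Derivation.leibniz, Derivation.leibniz_pow, add_comm,
      ← Nat.cast_smul_eq_nsmul (Spoly ℓ) k, ← mul_smul, ← mul_smul,
      mul_assoc]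
  rw [Finset.sum_congr rfl h1, Finset.sum_add_distrib, ← Finset.sum_smul]
  have h2 : q.derivative.eval u =
      ∑ k ∈ Finset.range (q.natDegree + 1), q.coeff k * (k * u ^ (k - 1)) := by
    rw [Polynomial.derivative_eval, Polynomial.sum_over_range _ (by simp)]
    exact Finset.sum_congr rfl fun k _ => by ring
  rw [h2, add_sub_cancel_right]
  exact I.sum_mem fun k _ => I.smul_mem _ (hI _ (hq k))

open Classical in
/-- The value at `u` of the derivative of the orbit polynomial of `u`. -/
noncomputable def orbDisc (u : Spoly ℓ) : Spoly ℓ := ∏ v ∈ (orbFinset hW u).erase u, (u - v)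

lemma eval_orbProd_self (u : Spoly ℓ) : (orbProd hW u u).eval u = orbDisc hW u := by
  simp [orbProd, orbDisc, Polynomial.eval_prod]

lemma self_mem_orbFinset (u : Spoly ℓ) : u ∈ orbFinset hW u := by
  classical
  simp only [orbFinset, Finset.mem_image, Set.Finite.mem_toFinset, SetLike.mem_coe]
  exact ⟨1, W.one_mem, by rw [Units.val_one, matSub_one, AlgHom.id_apply]⟩

lemma orbDisc_smul_derivation_mem (hI : ∀ p ∈ InvPoly W, δ p ∈ I) (u : Spoly ℓ) :
    orbDisc hW u • δ u ∈ I := by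
  classical
  set Φ : Polynomial (Spoly ℓ) := (Polynomial.X - Polynomial.C u) * orbProd hW u u with hΦ
  have hΦ' : Φ = ∏ v ∈ orbFinset hW u, (Polynomial.X - Polynomial.C v) :=
    Finset.mul_prod_erase (orbFinset hW u) (fun v => Polynomial.X - Polynomial.C v)
      (self_mem_orbFinset hW u)
  have hinv : ∀ k, Φ.coeff k ∈ InvPoly W := by
    refine coeff_mem_InvPoly fun h hh => ?_
    rw [hΦ', Polynomial.map_prod]
    nth_rewrite 2 [← image_orbFinset hW u hh]
    rw [Finset.prod_image (matSub_injective h).injOn]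
    simp
  have h0 : Φ.eval u = 0 := by simp [hΦ]
  have h1 : Φ.derivative.eval u = orbDisc hW u := by
    simp [hΦ, Polynomial.derivative_mul, eval_orbProd_self]
  have := derivation_eval_sub_mem δ I hI u hinv
  rw [h0, h1, map_zero, zero_sub] at this
  exact I.neg_mem_iff.1 this

lemma eval_orbInterp (u : Spoly ℓ) :
    ∃ n : ℕ, n ≠ 0 ∧ ∀ y, (∀ g ∈ W, matSub (g : Matrix (Fin ℓ) (Fin ℓ) ℝ) u = u →
      matSub (g : Matrix (Fin ℓ) (Fin ℓ) ℝ) y = y) →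
      (orbInterp hW u y).eval u = n * (y * orbDisc hW u) := by
  classical
  refine ⟨(hW.toFinset.filter
    fun g : Matrix.GeneralLinearGroup (Fin ℓ) ℝ =>
      matSub (g : Matrix (Fin ℓ) (Fin ℓ) ℝ) u = u).card, ?_, ?_⟩
  · rw [Finset.card_ne_zero]
    exact ⟨1, by simp [W.one_mem, matSub_one]⟩
  intro y hy
  rw [orbInterp, Polynomial.eval_finsetSum, Finset.card_filter, Nat.cast_sum, Finset.sum_mul]
  refine Finset.sum_congr rfl fun g hg => ?_
  simp only [Set.Finite.mem_toFinset, SetLike.mem_coe] at hg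
  rw [Polynomial.eval_mul, Polynomial.eval_C]
  split_ifs with h
  · rw [h, eval_orbProd_self, hy g hg h]; simp
  · rw [orbProd, Polynomial.eval_prod, Finset.prod_eq_zero (i := u)]
    · simp
    · exact Finset.mem_erase.2 ⟨Ne.symm h, self_mem_orbFinset hW u⟩
    · simp

lemma orbDisc_sq_smul_derivation_mem (hI : ∀ p ∈ InvPoly W, δ p ∈ I) (u y : Spoly ℓ)
    (hy : ∀ g ∈ W, matSub (g : Matrix (Fin ℓ) (Fin ℓ) ℝ) u = u →
      matSub (g : Matrix (Fin ℓ) (Fin ℓ) ℝ) y = y) :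
    (orbDisc hW u * orbDisc hW u) • δ y ∈ I := by
  set e := orbDisc hW u with he
  have hu : e • δ u ∈ I := orbDisc_smul_derivation_mem hW δ I hI u
  obtain ⟨n, hn, hev⟩ := eval_orbInterp hW u
  have key : ∀ y, (∀ g ∈ W, matSub (g : Matrix (Fin ℓ) (Fin ℓ) ℝ) u = u →
      matSub (g : Matrix (Fin ℓ) (Fin ℓ) ℝ) y = y) → e • δ (y * e) ∈ I := by
    intro y hy
    have h1 := derivation_eval_sub_mem δ I hI u
      (coeff_mem_InvPoly fun h hh => map_orbInterp hW u y hh)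
    rw [hev y hy, ← he] at h1
    have h2 := I.add_mem (I.smul_mem e h1)
      (I.smul_mem ((orbInterp hW u y).derivative.eval u) hu)
    rw [smul_sub, smul_comm e, sub_add_cancel, ← nsmul_eq_mul, map_nsmul] at h2
    have h3 := I.smul_mem (C ((n : ℝ)⁻¹)) h2
    have hn' : (n : ℝ) ≠ 0 := Nat.cast_ne_zero.2 hn
    convert h3 using 1
    rw [smul_comm (C _) e, ← Nat.cast_smul_eq_nsmul (Spoly ℓ) n, smul_smul (C _),
      ← map_natCast (C : ℝ →+* Spoly ℓ), ← C_mul, inv_mul_cancel₀ hn', C_1, one_smul]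
  have h1 := key y hy
  have h2 := key 1 fun g _ _ => map_one _
  rw [one_mul] at h2
  rw [Derivation.leibniz, smul_add] at h1
  have h3 := I.sub_mem h1 (I.smul_mem y h2)
  rwa [smul_comm e y, add_sub_cancel_left, smul_smul] at h3

end OrbitPolynomial

/-! ### Generic vectors on a hyperplane -/

section Generic

variable {W : Subgroup (Matrix.GeneralLinearGroup (Fin ℓ) ℝ)}

lemma mulVec_dotProduct_mulVec {M : Matrix (Fin ℓ) (Fin ℓ) ℝ} (hM : M.transpose * M = 1)
    (v w : Fin ℓ → ℝ) : M.mulVec v ⬝ᵥ M.mulVec w = v ⬝ᵥ w := by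
  rw [Matrix.dotProduct_mulVec, Matrix.vecMul_mulVec, hM, Matrix.vecMul_one]

/-- An orthogonal matrix fixing the hyperplane `a⊥` pointwise is `1` or the reflection. -/
lemma eq_one_or_eq_reflMat {a : Fin ℓ → ℝ} (ha : a ≠ 0) {M : Matrix (Fin ℓ) (Fin ℓ) ℝ}
    (hM : M.transpose * M = 1) (hfix : ∀ v, a ⬝ᵥ v = 0 → M.mulVec v = v) :
    M = 1 ∨ M = reflMat a := by
  have haa : a ⬝ᵥ a ≠ 0 := fun h => ha (dotProduct_self_eq_zero.1 h)
  set w := M.mulVec a with hw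
  have hperp : ∀ v, a ⬝ᵥ v = 0 → w ⬝ᵥ v = 0 := by
    intro v hv
    rw [← hv, ← mulVec_dotProduct_mulVec hM a v, hfix v hv]
  set c := a ⬝ᵥ w / a ⬝ᵥ a with hc
  have h1 : a ⬝ᵥ (w - c • a) = 0 := by
    rw [dotProduct_sub, dotProduct_smul, smul_eq_mul, hc, div_mul_cancel₀ _ haa, sub_self]
  have h2 : w = c • a := by
    rw [← sub_eq_zero, ← dotProduct_self_eq_zero, sub_dotProduct, smul_dotProduct, h1,
      hperp _ h1]
    simp
  have h3 : c ^ 2 = 1 := by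
    have := mulVec_dotProduct_mulVec hM a a
    rw [← hw, h2, smul_dotProduct, dotProduct_smul, smul_eq_mul, smul_eq_mul] at this
    have h4 : (c ^ 2 - 1) * (a ⬝ᵥ a) = 0 := by linarith
    rcases mul_eq_zero.1 h4 with h | h
    · linarith
    · exact absurd h haa
  have h4 : ∀ v, M.mulVec v = v + ((a ⬝ᵥ v) / (a ⬝ᵥ a) * (c - 1)) • a := by
    intro v
    have h5 : a ⬝ᵥ (v - ((a ⬝ᵥ v) / (a ⬝ᵥ a)) • a) = 0 := by
      rw [dotProduct_sub, dotProduct_smul, smul_eq_mul, div_mul_cancel₀ _ haa, sub_self]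
    have h6 := hfix _ h5
    rw [Matrix.mulVec_sub, Matrix.mulVec_smul, ← hw, h2, sub_eq_iff_eq_add] at h6
    rw [h6]
    module
  rcases sq_eq_one_iff.1 h3 with h | h
  · left
    refine Matrix.mulVec_injective (funext fun v => ?_)
    rw [h4, h]; simp
  · right
    refine Matrix.mulVec_injective (funext fun v => ?_)
    rw [h4, h, reflMat_mulVec]
    module

lemma coe_mul_transpose_of_orthogonal {g : Matrix.GeneralLinearGroup (Fin ℓ) ℝ}
    (hg : (g : Matrix (Fin ℓ) (Fin ℓ) ℝ).transpose * (g : Matrix (Fin ℓ) (Fin ℓ) ℝ) = 1) :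
    (g : Matrix (Fin ℓ) (Fin ℓ) ℝ) * (g : Matrix (Fin ℓ) (Fin ℓ) ℝ).transpose = 1 :=
  mul_eq_one_comm.1 hg

lemma exists_generic (hW : (W : Set (Matrix.GeneralLinearGroup (Fin ℓ) ℝ)).Finite)
    (hO : ∀ g ∈ W, (g : Matrix (Fin ℓ) (Fin ℓ) ℝ).transpose * (g : Matrix (Fin ℓ) (Fin ℓ) ℝ) = 1)
    {a : Fin ℓ → ℝ} (ha : a ≠ 0) :
    ∃ b : Fin ℓ → ℝ, a ⬝ᵥ b = 0 ∧ ∀ g ∈ W,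
      (g : Matrix (Fin ℓ) (Fin ℓ) ℝ).transpose.mulVec b = b →
      (g : Matrix (Fin ℓ) (Fin ℓ) ℝ) = 1 ∨ (g : Matrix (Fin ℓ) (Fin ℓ) ℝ) = reflMat a := by
  classical
  have haa : a ⬝ᵥ a ≠ 0 := fun h => ha (dotProduct_self_eq_zero.1 h)
  let pr : (Fin ℓ → ℝ) →ₗ[ℝ] (Fin ℓ → ℝ) :=
    Matrix.toLin' ((a ⬝ᵥ a) • (1 : Matrix (Fin ℓ) (Fin ℓ) ℝ) - Matrix.vecMulVec a a)
  have hpr : ∀ v, pr v = (a ⬝ᵥ a) • v - (a ⬝ᵥ v) • a := by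
    intro v
    simp only [pr, Matrix.toLin'_apply, Matrix.sub_mulVec, Matrix.smul_mulVec, Matrix.one_mulVec,
      Matrix.vecMulVec_mulVec, op_smul_eq_smul]
  have hpa : ∀ v, a ⬝ᵥ pr v = 0 := by
    intro v
    rw [hpr, dotProduct_sub, dotProduct_smul, dotProduct_smul, smul_eq_mul, smul_eq_mul]
    ring
  let K : Matrix.GeneralLinearGroup (Fin ℓ) ℝ → Subspace ℝ (Fin ℓ → ℝ) := fun g =>
    LinearMap.ker ((Matrix.toLin' (g : Matrix (Fin ℓ) (Fin ℓ) ℝ).transpose - LinearMap.id) ∘ₗ pr)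
  have hK : ∀ g v, v ∈ K g ↔ (g : Matrix (Fin ℓ) (Fin ℓ) ℝ).transpose.mulVec (pr v) = pr v := by
    intro g v
    simp only [K, LinearMap.mem_ker, LinearMap.comp_apply, LinearMap.sub_apply,
      Matrix.toLin'_apply, LinearMap.id_apply, sub_eq_zero]
  let s : Finset (Subspace ℝ (Fin ℓ → ℝ)) :=
    (hW.toFinset.filter fun g : Matrix.GeneralLinearGroup (Fin ℓ) ℝ =>
      ¬ ((g : Matrix (Fin ℓ) (Fin ℓ) ℝ) = 1 ∨ (g : Matrix (Fin ℓ) (Fin ℓ) ℝ) = reflMat a)).image K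
  have hs : ⊤ ∉ s := by
    intro h
    simp only [s, Finset.mem_image, Finset.mem_filter, Set.Finite.mem_toFinset,
      SetLike.mem_coe] at h
    obtain ⟨g, ⟨hg, hne⟩, htop⟩ := h
    have hfix : ∀ v, a ⬝ᵥ v = 0 → (g : Matrix (Fin ℓ) (Fin ℓ) ℝ).transpose.mulVec v = v := by
      intro v hv
      have h1 : v ∈ K g := htop ▸ Submodule.mem_top
      rw [hK, hpr, hv, zero_smul, sub_zero, Matrix.mulVec_smul] at h1
      exact smul_right_injective _ haa h1
    apply hne
    rcases eq_one_or_eq_reflMat ha (by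
      rw [Matrix.transpose_transpose]; exact coe_mul_transpose_of_orthogonal (hO g hg)) hfix
      with h | h
    · left; rw [← Matrix.transpose_transpose (g : Matrix (Fin ℓ) (Fin ℓ) ℝ), h,
        Matrix.transpose_one]
    · right; rw [← Matrix.transpose_transpose (g : Matrix (Fin ℓ) (Fin ℓ) ℝ), h,
        reflMat_transpose]
  have := Subspace.biUnion_ne_univ_of_top_notMem hs
  obtain ⟨v, hv⟩ := (Set.ne_univ_iff_exists_notMem _).1 this
  refine ⟨pr v, hpa v, fun g hg hfix => ?_⟩
  by_contra hne
  apply hv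
  simp only [Set.mem_iUnion]
  refine ⟨K g, ?_, (hK g v).2 hfix⟩
  simp only [s, Finset.mem_image, Finset.mem_filter, Set.Finite.mem_toFinset, SetLike.mem_coe]
  exact ⟨g, ⟨hg, hne⟩, rfl⟩

lemma not_dvd_orbDisc (hW : (W : Set (Matrix.GeneralLinearGroup (Fin ℓ) ℝ)).Finite)
    (hO : ∀ g ∈ W, (g : Matrix (Fin ℓ) (Fin ℓ) ℝ).transpose * (g : Matrix (Fin ℓ) (Fin ℓ) ℝ) = 1)
    {a b : Fin ℓ → ℝ} (ha : a ≠ 0) (hab : a ⬝ᵥ b = 0) :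
    ¬ linForm a ∣ orbDisc hW (linForm b) := by
  classical
  intro h
  rw [orbDisc, (prime_linForm ha).dvd_finsetProd_iff] at h
  obtain ⟨v, hv, hdvd⟩ := h
  obtain ⟨hne, hv⟩ := Finset.mem_erase.1 hv
  simp only [orbFinset, Finset.mem_image, Set.Finite.mem_toFinset, SetLike.mem_coe] at hv
  obtain ⟨g, hg, rfl⟩ := hv
  rw [matSub_linForm, ← linForm_sub] at hdvd
  obtain ⟨c, hc⟩ := exists_smul_of_linForm_dvd ha hdvd
  have h1 : (g : Matrix (Fin ℓ) (Fin ℓ) ℝ).transpose.mulVec b = b - c • a := by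
    rw [← hc, sub_sub_cancel]
  have h2 := mulVec_dotProduct_mulVec (M := (g : Matrix (Fin ℓ) (Fin ℓ) ℝ).transpose)
    (by rw [Matrix.transpose_transpose]; exact coe_mul_transpose_of_orthogonal (hO g hg)) b b
  have hba : b ⬝ᵥ a = 0 := by rw [dotProduct_comm, hab]
  have h3 : c * (c * (a ⬝ᵥ a)) = 0 := by
    rw [h1] at h2
    simp only [sub_dotProduct, dotProduct_sub, smul_dotProduct, dotProduct_smul, hab, hba,
      smul_eq_mul] at h2
    linarith
  have hc0 : c = 0 := by
    have haa : a ⬝ᵥ a ≠ 0 := fun h => ha (dotProduct_self_eq_zero.1 h)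
    simpa [haa] using h3
  rw [hc0, zero_smul, sub_zero] at h1
  exact hne (by rw [matSub_linForm, h1])

/-- A derivation with values in `I` on invariants takes reflection-invariant polynomials to `I`,
up to a factor prime to the reflecting form. -/
lemma exists_smul_derivation_mem (hW : (W : Set (Matrix.GeneralLinearGroup (Fin ℓ) ℝ)).Finite)
    (hO : ∀ g ∈ W, (g : Matrix (Fin ℓ) (Fin ℓ) ℝ).transpose * (g : Matrix (Fin ℓ) (Fin ℓ) ℝ) = 1)
    {a : Fin ℓ → ℝ} (ha : a ≠ 0) (δ : Derivation ℝ (Spoly ℓ) (Ffield ℓ))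
    (I : Submodule (Spoly ℓ) (Ffield ℓ)) (hI : ∀ p ∈ InvPoly W, δ p ∈ I) {y : Spoly ℓ}
    (hy : matSub (reflMat a) y = y) : ∃ q : Spoly ℓ, ¬ linForm a ∣ q ∧ q • δ y ∈ I := by
  obtain ⟨b, hab, hb⟩ := exists_generic hW hO ha
  have hd := not_dvd_orbDisc hW hO ha hab
  refine ⟨_, fun h => ?_, orbDisc_sq_smul_derivation_mem hW δ I hI (linForm b) y ?_⟩
  · rcases (prime_linForm ha).dvd_or_dvd h with h | h <;> exact hd h
  · intro g hg hgb
    rw [matSub_linForm] at hgb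
    rcases hb g hg (linForm_injective hgb) with h | h
    · rw [h, matSub_one, AlgHom.id_apply]
    · rw [h, hy]

lemma smul_eq_toF_mul (p : Spoly ℓ) (f : Ffield ℓ) : p • f = toF p * f := Algebra.smul_def p f

lemma derivation_mem_Sloc_of_invariants
    (hW : (W : Set (Matrix.GeneralLinearGroup (Fin ℓ) ℝ)).Finite)
    (hO : ∀ g ∈ W, (g : Matrix (Fin ℓ) (Fin ℓ) ℝ).transpose * (g : Matrix (Fin ℓ) (Fin ℓ) ℝ) = 1)
    {a : Fin ℓ → ℝ} (ha : a ≠ 0) (D : Derivation ℝ (Ffield ℓ) (Ffield ℓ))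
    (hD : ∀ p ∈ InvPoly W, D (toF p) ∈ Sreg ℓ) {y : Spoly ℓ}
    (hy : matSub (reflMat a) y = y) : D (toF y) ∈ Sloc a := by
  obtain ⟨q, hq, p, hp⟩ := exists_smul_derivation_mem hW hO ha (D.compAlgebraMap (Spoly ℓ))
    (LinearMap.range (Algebra.linearMap (Spoly ℓ) (Ffield ℓ)))
    (fun p hp => by obtain ⟨r, hr⟩ := hD p hp; exact ⟨r, hr⟩) hy
  refine ⟨p, q, hq, ?_⟩
  rw [mul_comm, ← smul_eq_toF_mul]
  exact hp.symm

/-- A derivation of polynomials vanishing on the invariants vanishes. -/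
lemma derivation_eq_zero_of_invariants
    (hW : (W : Set (Matrix.GeneralLinearGroup (Fin ℓ) ℝ)).Finite)
    (hO : ∀ g ∈ W, (g : Matrix (Fin ℓ) (Fin ℓ) ℝ).transpose * (g : Matrix (Fin ℓ) (Fin ℓ) ℝ) = 1)
    {a : Fin ℓ → ℝ} (ha : a ≠ 0) (δ : Derivation ℝ (Spoly ℓ) (Ffield ℓ))
    (hδ : ∀ p ∈ InvPoly W, δ p = 0) : δ = 0 := by
  have heven : ∀ y, matSub (reflMat a) y = y → δ y = 0 := by
    intro y hy
    obtain ⟨q, hq, hqy⟩ := exists_smul_derivation_mem hW hO ha δ ⊥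
      (fun p hp => by rw [hδ p hp]; exact Submodule.zero_mem _) hy
    rw [Submodule.mem_bot, smul_eq_toF_mul] at hqy
    exact (mul_eq_zero.1 hqy).resolve_left (toF_ne_zero_of_not_dvd hq)
  have hα : δ (linForm a) = 0 := by
    have h1 := heven (linForm a * linForm a) (by
      rw [map_mul, matSub_linForm, reflMat_transpose, reflMat_mulVec_self ha,
        ← neg_one_smul ℝ a, linForm_smul]
      simp)
    rw [Derivation.leibniz, ← add_smul, smul_eq_toF_mul] at h1
    refine (mul_eq_zero.1 h1).resolve_left fun h => linForm_ne_zero ha ?_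
    rw [toF_eq_zero, ← two_mul] at h
    exact (mul_eq_zero.1 h).resolve_left two_ne_zero
  have haa : a ⬝ᵥ a ≠ 0 := fun h => ha (dotProduct_self_eq_zero.1 h)
  refine derivation_ext fun x => ?_
  set v : Fin ℓ → ℝ := Pi.single x 1 with hv
  set c := a ⬝ᵥ v / a ⬝ᵥ a with hc
  have h1 : a ⬝ᵥ (v - c • a) = 0 := by
    rw [dotProduct_sub, dotProduct_smul, smul_eq_mul, hc, div_mul_cancel₀ _ haa, sub_self]
  have h2 := heven (linForm (v - c • a)) (by
    rw [matSub_linForm, reflMat_transpose, reflMat_mulVec_of_orthogonal h1])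
  rw [linForm_sub, linForm_smul, map_sub, Derivation.leibniz, hα, derivation_C, smul_zero,
    smul_zero, add_zero, sub_zero, hv, linForm_single] at h2
  rw [h2, Derivation.zero_apply]

end Generic

/-! ### Weights -/

lemma derivation_apply_eq_sum (δ : Derivation ℝ (Spoly ℓ) (Ffield ℓ)) (p : Spoly ℓ) :
    δ p = ∑ x, toF (pderiv x p) * δ (X x) := by
  induction p using MvPolynomial.induction_on with
  | C r => simp
  | add p q hp hq => simp only [map_add, hp, hq, toF_add, add_mul, Finset.sum_add_distrib]
  | mul_X p y hp =>
    have h1 : ∀ x, toF (pderiv x (p * X y)) * δ (X x) =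
        toF p * (if x = y then δ (X x) else 0) + toF (X y) * (toF (pderiv x p) * δ (X x)) := by
      intro x
      rw [Derivation.leibniz, pderiv_X, smul_eq_mul, smul_eq_mul, toF_add, toF_mul, toF_mul]
      split_ifs with h
      · subst h
        rw [Pi.single_eq_same, toF_one]; ring
      · rw [Pi.single_eq_of_ne (Ne.symm h), toF_zero]; ring
    rw [Derivation.leibniz, hp, smul_eq_toF_mul, smul_eq_toF_mul,
      Finset.sum_congr rfl fun x _ => h1 x, Finset.sum_add_distrib, ← Finset.mul_sum, ← Finset.mul_sum]
    simp

/-- The dilation `v ↦ v / 2`. -/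
noncomputable def dilation (ℓ : ℕ) : Matrix.GeneralLinearGroup (Fin ℓ) ℝ where
  val := (2 : ℝ)⁻¹ • 1
  inv := (2 : ℝ) • 1
  val_inv := by simp
  inv_val := by simp

lemma coeff_matSub_two (p : Spoly ℓ) (m : Fin ℓ →₀ ℕ) :
    coeff m (matSub ((2 : ℝ) • 1) p) = 2 ^ m.degree * coeff m p := by
  have hX : ∀ x, matSub ((2 : ℝ) • (1 : Matrix (Fin ℓ) (Fin ℓ) ℝ)) (X x) = C 2 * X x := by
    intro x
    rw [matSub_X, ← linForm_single x, ← linForm_smul]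
    congr 1
    ext y
    simp [Matrix.one_apply, Pi.single_apply, eq_comm]
  induction p using MvPolynomial.induction_on' with
  | add p q hp hq => rw [map_add, coeff_add, coeff_add, hp, hq, mul_add]
  | monomial n r =>
    have h1 : matSub ((2 : ℝ) • (1 : Matrix (Fin ℓ) (Fin ℓ) ℝ)) (monomial n r) =
        C (2 ^ n.degree) * monomial n r := by
      rw [monomial_eq, map_mul, Finsupp.prod, map_prod, ← algebraMap_eq, AlgHom.commutes]
      simp only [map_pow, hX, mul_pow, Finset.prod_mul_distrib]
      rw [Finset.prod_pow_eq_pow_sum, Finsupp.degree_apply, algebraMap_eq]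
      ring
    rw [h1, coeff_C_mul, coeff_monomial]
    split_ifs with h
    · rw [h]
    · simp

lemma fAct_dilation_toF (p : Spoly ℓ) :
    fAct (dilation ℓ) (toF p) = toF (matSub ((2 : ℝ) • 1) p) := by
  rw [fAct_toF]; rfl

lemma fAct_dilation_of_isHomogeneous {p : Spoly ℓ} {d : ℕ} (hp : p.IsHomogeneous d) :
    fAct (dilation ℓ) (toF p) = 2 ^ d * toF p := by
  have h1 : matSub ((2 : ℝ) • 1) p = 2 ^ d * p := by
    rw [← map_ofNat C 2, ← C_pow]
    ext m
    rw [coeff_matSub_two, coeff_C_mul]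
    by_cases h : coeff m p = 0
    · simp [h]
    · have h2 : m.degree = d := by rw [Finsupp.degree_eq_weight_one]; exact hp h
      rw [h2]
  rw [fAct_dilation_toF, h1, toF_mul, toF_pow]
  congr 2
  exact map_ofNat (algebraMap (Spoly ℓ) (Ffield ℓ)) 2

lemma eq_zero_of_fAct_dilation {z : Ffield ℓ} (hz : z ∈ Sreg ℓ) {k : ℕ} (hk : 0 < k)
    (h : 2 ^ k * fAct (dilation ℓ) z = z) : z = 0 := by
  obtain ⟨p, rfl⟩ := hz
  change 2 ^ k * fAct (dilation ℓ) (toF p) = toF p at h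
  have h2 : (toF (C (2 ^ k)) : Ffield ℓ) = 2 ^ k := by
    rw [C_pow, toF_pow]
    congr 1
    exact (congrArg toF (map_ofNat C 2)).trans (map_ofNat (algebraMap (Spoly ℓ) (Ffield ℓ)) 2)
  rw [fAct_dilation_toF, ← h2, ← toF_mul] at h
  have h3 := toF_injective h
  have h4 : p = 0 := by
    ext m
    have h5 := congrArg (coeff m) h3
    rw [coeff_C_mul, coeff_matSub_two, ← mul_assoc, ← pow_add] at h5
    have h6 : (1 : ℝ) < 2 ^ (k + m.degree) := one_lt_pow₀ one_lt_two (by lia)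
    rw [coeff_zero]
    by_contra hne
    have := mul_right_cancel₀ hne (h5.trans (one_mul _).symm)
    linarith
  rw [h4]; exact map_zero _

lemma pderiv_eq_zero_of_blockPoly {blk : Fin ℓ → Fin t} {i : Fin t} {p : Spoly ℓ}
    (hp : blockPoly blk i p) {x : Fin ℓ} (hx : blk x ≠ i) : pderiv x p = 0 := by
  apply pderiv_eq_zero_of_notMem_vars
  intro h
  obtain ⟨m, hm, hxm⟩ := (mem_vars_iff_mem_support x).1 h
  exact hx (hp m hm x hxm)

section Setup

variable (cox : CoxeterSetup ℓ t)

lemma derivation_mem_of_basic (δ : Derivation ℝ (Spoly ℓ) (Ffield ℓ))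
    (I : Submodule (Spoly ℓ) (Ffield ℓ)) (h : ∀ c, δ (cox.P c) ∈ I) :
    ∀ p ∈ InvPoly cox.W, δ p ∈ I := by
  intro p hp
  have hp' := (cox.hPgen p).1 hp
  induction hp' using Algebra.adjoin_induction with
  | mem x hx => obtain ⟨c, rfl⟩ := hx; exact h c
  | algebraMap r => rw [Derivation.map_algebraMap]; exact I.zero_mem
  | add x y hx hy h1 h2 =>
    rw [map_add]
    exact I.add_mem (h1 ((cox.hPgen x).2 hx)) (h2 ((cox.hPgen y).2 hy))
  | mul x y hx hy h1 h2 =>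
    rw [Derivation.leibniz]
    exact I.add_mem (I.smul_mem _ (h2 ((cox.hPgen y).2 hy)))
      (I.smul_mem _ (h1 ((cox.hPgen x).2 hx)))

lemma derivation_ext_of_basic {a : Fin ℓ → ℝ} (ha : a ≠ 0)
    {δ₁ δ₂ : Derivation ℝ (Spoly ℓ) (Ffield ℓ)} (h : ∀ c, δ₁ (cox.P c) = δ₂ (cox.P c)) :
    δ₁ = δ₂ := by
  rw [← sub_eq_zero]
  refine derivation_eq_zero_of_invariants cox.hWfin cox.hWorth ha _ fun p hp => ?_
  have := derivation_mem_of_basic cox (δ₁ - δ₂) ⊥ (fun c => by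
    rw [Derivation.sub_apply, h c, sub_self]; exact Submodule.zero_mem _) p hp
  exact (Submodule.mem_bot _).1 this

variable (D : Derivation ℝ (Ffield ℓ) (Ffield ℓ))
  (hDP : ∀ c, D (toF (cox.P c)) = if c = cox.top (cox.blk c) then 1 else 0)

include hDP

lemma primitive_mem_Sreg : ∀ p ∈ InvPoly cox.W, D (toF p) ∈ Sreg ℓ := by
  intro p hp
  obtain ⟨r, hr⟩ := derivation_mem_of_basic cox (D.compAlgebraMap (Spoly ℓ))
    (LinearMap.range (Algebra.linearMap (Spoly ℓ) (Ffield ℓ))) (fun c => by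
      change D (toF (cox.P c)) ∈ _
      rw [hDP c]
      split_ifs
      · exact ⟨1, toF_one⟩
      · exact Submodule.zero_mem _) p hp
  exact ⟨r, hr⟩

/-- On the block `i`, the primitive derivation has weight minus the Coxeter number. -/
lemma fAct_dilation_primitive {a : Fin ℓ → ℝ} (ha : a ≠ 0) (x : Fin ℓ) :
    2 ^ cox.deg (cox.top (cox.blk x)) * fAct (dilation ℓ) (D (XF x)) = 2 * D (XF x) := by
  have h2 : (2 : Ffield ℓ) ≠ 0 := two_ne_zero
  let δ : Derivation ℝ (Spoly ℓ) (Ffield ℓ) := mkDerivation ℝ fun x =>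
    2⁻¹ * (2 ^ cox.deg (cox.top (cox.blk x)) * fAct (dilation ℓ) (D (XF x)))
  have hδX : ∀ x, δ (X x) =
      2⁻¹ * (2 ^ cox.deg (cox.top (cox.blk x)) * fAct (dilation ℓ) (D (XF x))) :=
    mkDerivation_X ℝ _
  have hδ : δ = D.compAlgebraMap (Spoly ℓ) := by
    refine derivation_ext_of_basic cox ha fun c => ?_
    have h3 : D (toF (cox.P c)) = ∑ x, toF (pderiv x (cox.P c)) * D (XF x) :=
      derivation_apply_eq_sum (D.compAlgebraMap (Spoly ℓ)) (cox.P c)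
    have h4 : ∀ x, fAct (dilation ℓ) (toF (pderiv x (cox.P c))) =
        2⁻¹ * 2 ^ cox.deg c * toF (pderiv x (cox.P c)) := by
      intro x
      rw [fAct_dilation_of_isHomogeneous (cox.hPhom c).pderiv, pow_sub₀ _ h2 (cox.hdeg c), pow_one]
      ring
    have h5 : 2 ^ cox.deg c * δ (cox.P c) =
        2 ^ cox.deg (cox.top (cox.blk c)) * fAct (dilation ℓ) (D (toF (cox.P c))) := by
      rw [h3, map_sum, derivation_apply_eq_sum, Finset.mul_sum, Finset.mul_sum]
      refine Finset.sum_congr rfl fun x _ => ?_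
      by_cases hx : cox.blk x = cox.blk c
      · rw [map_mul, h4, hδX, hx]; ring
      · rw [pderiv_eq_zero_of_blockPoly (cox.hPblock c) hx]; simp
    have h6 : 2 ^ cox.deg c * δ (cox.P c) = 2 ^ cox.deg c * D (toF (cox.P c)) := by
      rw [h5, hDP c]
      split_ifs with h
      · rw [← h, map_one]
      · rw [map_zero, mul_zero, mul_zero]
    exact mul_left_cancel₀ (pow_ne_zero _ h2) h6
  have h7 := hδX x
  rw [hδ] at h7
  change D (XF x) = _ at h7
  rw [eq_inv_mul_iff_mul_eq₀ h2] at h7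
  exact h7.symm

lemma fAct_dilation_primitive_linF {a : Fin ℓ → ℝ} (ha : a ≠ 0) {b : Fin ℓ → ℝ} {i : Fin t}
    (hb : ∀ x, b x ≠ 0 → cox.blk x = i) :
    2 ^ cox.deg (cox.top i) * fAct (dilation ℓ) (D (linF b)) = 2 * D (linF b) := by
  have h1 : D (linF b) = ∑ x, cF (b x) * D (XF x) := by
    rw [linF, linForm, toF_sum, map_sum]
    refine Finset.sum_congr rfl fun x _ => ?_
    rw [toF_mul]
    change D (cF (b x) * XF x) = _
    rw [Derivation.leibniz, cF_eq_algebraMap, Derivation.map_algebraMap, smul_zero, add_zero,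
      smul_eq_mul]
  rw [h1, map_sum, Finset.mul_sum, Finset.mul_sum]
  refine Finset.sum_congr rfl fun x _ => ?_
  by_cases hx : b x = 0
  · simp [hx, cF]
  · have := fAct_dilation_primitive cox D hDP ha x
    rw [hb x hx] at this
    rw [map_mul, fAct_cF, mul_left_comm, this]
    ring

end Setup

/-! ### Pairing a form with a normal vector -/

/-- The contraction `I*(dα_a, ω)`. -/
noncomputable def pairF (a : Fin ℓ → ℝ) (ω : OmF ℓ) : Ffield ℓ := ∑ x, cF (a x) * ω x

@[simp] lemma cF_zero : (cF 0 : Ffield ℓ) = 0 := by simp [cF]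

@[simp] lemma cF_one : (cF 1 : Ffield ℓ) = 1 := by simp [cF]

lemma cF_sub (r s : ℝ) : (cF (r - s) : Ffield ℓ) = cF r - cF s := by simp [cF]

lemma cF_mul (r s : ℝ) : (cF (r * s) : Ffield ℓ) = cF r * cF s := by simp [cF]

lemma cF_sum {ι : Type*} (s : Finset ι) (f : ι → ℝ) :
    (cF (∑ i ∈ s, f i) : Ffield ℓ) = ∑ i ∈ s, cF (f i) := by simp [cF]

lemma cF_ne_zero {r : ℝ} (hr : r ≠ 0) : (cF r : Ffield ℓ) ≠ 0 := by simpa [cF] using hr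

lemma cF_mem_Sreg (r : ℝ) : (cF r : Ffield ℓ) ∈ Sreg ℓ := toF_mem_Sreg _

lemma cF_mem_Sloc {a : Fin ℓ → ℝ} (ha : a ≠ 0) (r : ℝ) : cF r ∈ Sloc a := toF_mem_Sloc ha _

lemma derivation_cF_mul (D : Derivation ℝ (Ffield ℓ) (Ffield ℓ)) (r : ℝ) (f : Ffield ℓ) :
    D (cF r * f) = cF r * D f := by
  rw [Derivation.leibniz, cF_eq_algebraMap, Derivation.map_algebraMap, smul_zero, add_zero,
    smul_eq_mul]

lemma linF_smul (c : ℝ) (a : Fin ℓ → ℝ) : linF (c • a) = cF c * linF a := by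
  rw [linF, linForm_smul, toF_mul]; rfl

lemma pairF_smul (c : ℝ) (a : Fin ℓ → ℝ) (ω : OmF ℓ) : pairF (c • a) ω = cF c * pairF a ω := by
  simp only [pairF, Pi.smul_apply, smul_eq_mul, cF_mul, mul_assoc, Finset.mul_sum]

lemma pairF_nabVec (D : Derivation ℝ (Ffield ℓ) (Ffield ℓ)) (a : Fin ℓ → ℝ) (ω : OmF ℓ) :
    pairF a (nabVec D ω) = D (pairF a ω) := by
  simp only [pairF, nabVec, map_sum, derivation_cF_mul]

section Orthogonal

variable {g : Matrix.GeneralLinearGroup (Fin ℓ) ℝ}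
  (hg : (g : Matrix (Fin ℓ) (Fin ℓ) ℝ).transpose * (g : Matrix (Fin ℓ) (Fin ℓ) ℝ) = 1)

include hg

lemma coe_inv_eq_transpose :
    (↑g⁻¹ : Matrix (Fin ℓ) (Fin ℓ) ℝ) = (g : Matrix (Fin ℓ) (Fin ℓ) ℝ).transpose := by
  calc (↑g⁻¹ : Matrix (Fin ℓ) (Fin ℓ) ℝ)
      = (g : Matrix (Fin ℓ) (Fin ℓ) ℝ).transpose * (g : Matrix (Fin ℓ) (Fin ℓ) ℝ) * ↑g⁻¹ := by
        rw [hg, one_mul]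
    _ = (g : Matrix (Fin ℓ) (Fin ℓ) ℝ).transpose := by rw [mul_assoc, Units.mul_inv, mul_one]

lemma fAct_linF (v : Fin ℓ → ℝ) :
    fAct g (linF v) = linF ((g : Matrix (Fin ℓ) (Fin ℓ) ℝ).mulVec v) := by
  rw [linF, fAct_toF, matSub_linForm, coe_inv_eq_transpose hg, Matrix.transpose_transpose, linF]

lemma pairF_mulVec {ω : OmF ℓ} (hω : vecAct g ω = ω) (v : Fin ℓ → ℝ) :
    pairF ((g : Matrix (Fin ℓ) (Fin ℓ) ℝ).mulVec v) ω = fAct g (pairF v ω) := by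
  set M := (g : Matrix (Fin ℓ) (Fin ℓ) ℝ) with hM
  have h1 : ∀ y, ∑ x, cF (M x y) * ω x = fAct g (ω y) := by
    intro y
    calc ∑ x, cF (M x y) * ω x = ∑ x, cF (M x y) * ∑ z, cF (M x z) * fAct g (ω z) :=
          Finset.sum_congr rfl fun x _ => by rw [← congrFun hω x]; rfl
      _ = ∑ z, cF (∑ x, M x y * M x z) * fAct g (ω z) := by
          simp only [Finset.mul_sum, cF_sum, cF_mul, Finset.sum_mul, mul_assoc]
          rw [Finset.sum_comm]
      _ = ∑ z, cF ((1 : Matrix (Fin ℓ) (Fin ℓ) ℝ) y z) * fAct g (ω z) := by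
          simp only [← hg, Matrix.mul_apply, Matrix.transpose_apply]
      _ = fAct g (ω y) := by
          simp [Matrix.one_apply, apply_ite cF, ite_mul]
  calc pairF (M.mulVec v) ω = ∑ y, cF (v y) * ∑ x, cF (M x y) * ω x := by
        simp only [pairF, Matrix.mulVec, dotProduct, cF_sum, cF_mul, Finset.sum_mul,
          Finset.mul_sum]
        rw [Finset.sum_comm]
        exact Finset.sum_congr rfl fun _ _ => Finset.sum_congr rfl fun _ _ => by ring
    _ = fAct g (pairF v ω) := by
        simp only [h1, pairF, map_sum, map_mul, fAct_cF]

lemma fAct_mem_Sloc {a : Fin ℓ → ℝ} {z : Ffield ℓ} (hz : z ∈ Sloc a) :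
    fAct g z ∈ Sloc ((g : Matrix (Fin ℓ) (Fin ℓ) ℝ).mulVec a) := by
  obtain ⟨p, q, hq, h⟩ := hz
  refine ⟨matSub (↑g⁻¹ : Matrix (Fin ℓ) (Fin ℓ) ℝ) p, matSub (↑g⁻¹ : Matrix (Fin ℓ) (Fin ℓ) ℝ) q,
    ?_, by rw [← fAct_toF, ← fAct_toF, ← map_mul, h]⟩
  intro hd
  apply hq
  have h1 := map_dvd (matSub (g : Matrix (Fin ℓ) (Fin ℓ) ℝ)) hd
  rw [matSub_matSub, inv_mul_cancel, Units.val_one, matSub_one, AlgHom.id_apply, matSub_linForm,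
    Matrix.mulVec_mulVec, hg, Matrix.one_mulVec] at h1
  exact h1

end Orthogonal

lemma fAct_pairF_of_reflMat {g : Matrix.GeneralLinearGroup (Fin ℓ) ℝ} {a : Fin ℓ → ℝ} (ha : a ≠ 0)
    (hg : (g : Matrix (Fin ℓ) (Fin ℓ) ℝ) = reflMat a) {ω : OmF ℓ} (hω : vecAct g ω = ω) :
    fAct g (pairF a ω) = -pairF a ω := by
  rw [← pairF_mulVec (by rw [hg, reflMat_transpose, reflMat_mul_self ha]) hω, hg,
    reflMat_mulVec_self ha, ← neg_one_smul ℝ a, pairF_smul]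
  simp [cF]

section Arrangement

variable {A : Finset (Fin ℓ → ℝ)} (hA0 : ∀ a ∈ A, a ≠ 0)
  (hA : ∀ a ∈ A, ∀ b ∈ A, (∃ c : ℝ, a = c • b) → a = b)

open Classical in
lemma QF_eq_mul {a : Fin ℓ → ℝ} (ha : a ∈ A) :
    (QF A : Ffield ℓ) = linF a * toF (∏ b ∈ A.erase a, linForm b) := by
  rw [QF, ← Finset.mul_prod_erase A linForm ha, toF_mul]; rfl

include hA0

open Classical in
lemma QF_div_linF {a : Fin ℓ → ℝ} (ha : a ∈ A) :
    (QF A : Ffield ℓ) / linF a = toF (∏ b ∈ A.erase a, linForm b) := by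
  rw [QF_eq_mul ha, mul_div_cancel_left₀ _ (linF_ne_zero (hA0 a ha))]

include hA

open Classical in
lemma not_dvd_prod_erase {a : Fin ℓ → ℝ} (ha : a ∈ A) :
    ¬ linForm a ∣ ∏ b ∈ A.erase a, linForm b := by
  rw [(prime_linForm (hA0 a ha)).dvd_finsetProd_iff]
  rintro ⟨b, hb, h⟩
  obtain ⟨hne, hb⟩ := Finset.mem_erase.1 hb
  exact hne (hA b hb a ha (exists_smul_of_linForm_dvd (hA0 a ha) h))

lemma mem_Sloc_of_QF_div_pow_mul {a : Fin ℓ → ℝ} (ha : a ∈ A) {N : ℕ} {z : Ffield ℓ}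
    (h : (QF A / linF a) ^ N * z ∈ Sloc a) : z ∈ Sloc a := by
  classical
  rw [QF_div_linF hA0 ha] at h
  have hq := not_dvd_prod_erase hA0 hA ha
  have hq' := toF_ne_zero_of_not_dvd hq
  have h1 : ((toF (∏ b ∈ A.erase a, linForm b))⁻¹ : Ffield ℓ) ^ N ∈ Sloc a :=
    (slocSubring (hA0 a ha)).pow_mem (inv_toF_mem_Sloc hq) N
  have h2 := Sloc_mul (hA0 a ha) h1 h
  rwa [← mul_assoc, ← mul_pow, inv_mul_cancel₀ hq', one_pow, one_mul] at h2

lemma wedge_mem_Sloc {ω : OmF ℓ} (hω : ω ∈ OmegaInf A) {a : Fin ℓ → ℝ} (ha : a ∈ A)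
    (x y : Fin ℓ) : cF (a x) * ω y - cF (a y) * ω x ∈ Sloc a := by
  obtain ⟨N, -, h⟩ := hω
  exact mem_Sloc_of_QF_div_pow_mul hA0 hA ha (Sreg_subset_Sloc (hA0 a ha) (h a ha x y))

lemma exists_linF_pow_mul_pairF_mem {ω : OmF ℓ} (hω : ω ∈ OmegaInf A) {a : Fin ℓ → ℝ}
    (ha : a ∈ A) : ∃ N : ℤ, linF a ^ N * pairF a ω ∈ Sloc a := by
  classical
  obtain ⟨N, h, -⟩ := hω
  refine ⟨N, ?_⟩
  rw [zpow_natCast]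
  refine mem_Sloc_of_QF_div_pow_mul hA0 hA ha (N := N) ?_
  rw [← mul_assoc, ← mul_pow, div_mul_cancel₀ _ (linF_ne_zero (hA0 a ha)), pairF, Finset.mul_sum]
  refine Sloc_sum (hA0 a ha) fun x _ => ?_
  rw [mul_left_comm]
  exact Sloc_mul (hA0 a ha) (cF_mem_Sloc (hA0 a ha) _) (Sreg_subset_Sloc (hA0 a ha) (h x))

/-- Inside `Ω(A,∞)`, membership in `Ω(A,m)` is a local condition along each hyperplane. -/
lemma mem_OmegaMult_iff {ω : OmF ℓ} (hω : ω ∈ OmegaInf A) (m : (Fin ℓ → ℝ) → ℤ) :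
    ω ∈ OmegaMult A m ↔ ∀ a ∈ A, linF a ^ m a * pairF a ω ∈ Sloc a := by
  classical
  constructor
  · rintro ⟨-, N, h⟩ a ha
    refine mem_Sloc_of_QF_div_pow_mul hA0 hA ha (N := N) (Sreg_subset_Sloc (hA0 a ha) ?_)
    rw [← mul_assoc]
    exact h a ha
  · intro h
    refine ⟨hω, ?_⟩
    obtain ⟨N, hN, -⟩ := hω
    refine ⟨N, fun a ha => ?_⟩
    obtain ⟨k, hk⟩ : ∃ k : ℕ, 0 ≤ k + m a := ⟨(m a).natAbs, by lia⟩
    have ha0 := linF_ne_zero (hA0 a ha)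
    refine mem_Sreg_of_linF_pow_mul (hA0 a ha) (n := N + k) ?_ ?_
    · have h1 : linF a ^ (N + k) * ((QF A / linF a) ^ N * linF a ^ m a * pairF a ω) =
          linF a ^ (k + m a).toNat * (QF A ^ N * pairF a ω) := by
        rw [div_pow, ← zpow_natCast _ (Int.toNat _), Int.toNat_of_nonneg hk, zpow_add₀ ha0,
          zpow_natCast, pow_add]
        field_simp
      change linF a ^ (N + k) * ((QF A / linF a) ^ N * linF a ^ m a * pairF a ω) ∈ _
      rw [h1, linF, ← toF_pow, pairF, Finset.mul_sum]
      refine Sreg_mul (toF_mem_Sreg _) (Sreg_sum fun x _ => ?_)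
      rw [mul_left_comm]
      exact Sreg_mul (cF_mem_Sreg _) (hN x)
    · rw [QF_div_linF hA0 ha, ← toF_pow, mul_assoc]
      exact Sloc_mul (hA0 a ha) (toF_mem_Sloc (hA0 a ha) _) (h a ha)

end Arrangement

/-! ### The logarithmic form of an orbit of roots -/

lemma cF_inv (r : ℝ) : (cF r⁻¹ : Ffield ℓ) = (cF r)⁻¹ := by
  rw [cF_eq_algebraMap, cF_eq_algebraMap, map_inv₀]

/-- The form `∑_{g ∈ W} dα_{ga} / α_{ga}`. -/
noncomputable def orbForm {W : Subgroup (Matrix.GeneralLinearGroup (Fin ℓ) ℝ)}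
    (hW : (W : Set (Matrix.GeneralLinearGroup (Fin ℓ) ℝ)).Finite) (a : Fin ℓ → ℝ) : OmF ℓ :=
  fun x => ∑ g ∈ hW.toFinset, cF ((g : Matrix (Fin ℓ) (Fin ℓ) ℝ).mulVec a x) *
    (linF ((g : Matrix (Fin ℓ) (Fin ℓ) ℝ).mulVec a))⁻¹

lemma pairF_orbForm {W : Subgroup (Matrix.GeneralLinearGroup (Fin ℓ) ℝ)}
    (hW : (W : Set (Matrix.GeneralLinearGroup (Fin ℓ) ℝ)).Finite) (a b : Fin ℓ → ℝ) :
    pairF b (orbForm hW a) = ∑ g ∈ hW.toFinset,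
      cF (b ⬝ᵥ (g : Matrix (Fin ℓ) (Fin ℓ) ℝ).mulVec a) *
        (linF ((g : Matrix (Fin ℓ) (Fin ℓ) ℝ).mulVec a))⁻¹ := by
  simp only [pairF, orbForm, Finset.mul_sum, dotProduct, cF_sum, cF_mul, Finset.sum_mul]
  rw [Finset.sum_comm]
  exact Finset.sum_congr rfl fun _ _ => Finset.sum_congr rfl fun _ _ => by ring

/-- The derivative of an invariant polynomial along the normal direction vanishes on the mirror. -/
lemma linForm_dvd_sum_pderiv {a : Fin ℓ → ℝ} (ha : a ≠ 0) {p : Spoly ℓ}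
    (hp : matSub (reflMat a) p = p) : linForm a ∣ ∑ x, C (a x) * pderiv x p := by
  let δ : Derivation ℝ (Spoly ℓ) (Spoly ℓ) := ∑ x, (C (a x) : Spoly ℓ) • pderiv x
  have hδ : ∀ q, δ q = ∑ x, C (a x) * pderiv x q := by
    intro q
    have h1 := congrFun (map_sum Derivation.coeFnAddMonoidHom
      (fun x => (C (a x) : Spoly ℓ) • pderiv (R := ℝ) x) Finset.univ) q
    rw [Finset.sum_apply] at h1
    exact h1
  have hX : ∀ v, δ (linForm v) = C (a ⬝ᵥ v) := by
    intro v
    rw [hδ]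
    simp only [linForm, map_sum, dotProduct]
    refine Finset.sum_congr rfl fun x _ => ?_
    rw [Finset.sum_eq_single x, C_mul, Derivation.leibniz, derivation_C, smul_zero, add_zero,
      pderiv_X_self, smul_eq_mul, mul_one]
    · intro y _ hy
      rw [Derivation.leibniz, derivation_C, smul_zero, add_zero, pderiv_X_of_ne hy, smul_zero]
    · simp
  have hanti : ∀ q, matSub (reflMat a) (δ q) = -δ (matSub (reflMat a) q) := by
    intro q
    induction q using MvPolynomial.induction_on with
    | C r =>
      rw [derivation_C, map_zero, ← algebraMap_eq, AlgHom.commutes, Derivation.map_algebraMap,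
        neg_zero]
    | add p q hp hq => simp only [map_add, hp, hq, neg_add]
    | mul_X p x hp =>
      have h1 : matSub (reflMat a) (δ (X x)) = -δ (matSub (reflMat a) (X x)) := by
        have h2 : a ⬝ᵥ reflMat a x = -(a ⬝ᵥ Pi.single x 1) := by
          have h3 := congrFun (reflMat_mulVec_self ha) x
          rw [Matrix.mulVec, dotProduct_comm] at h3
          rw [h3]; simp
        rw [matSub_X, hX, h2, ← linForm_single, hX, ← algebraMap_eq, AlgHom.commutes, map_neg,
          neg_neg]
      rw [Derivation.leibniz, map_mul, Derivation.leibniz, map_add]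
      simp only [smul_eq_mul, map_mul, hp, h1]
      ring
  have h1 := linForm_dvd_sub_matSub_reflMat a (δ p)
  rw [hanti, hp, sub_neg_eq_add, ← two_mul] at h1
  rw [← hδ]
  refine ((prime_linForm ha).dvd_or_dvd h1).resolve_left fun h => ?_
  refine (prime_linForm ha).not_isUnit (isUnit_of_dvd_unit h ?_)
  rw [← map_ofNat C 2]
  exact (isUnit_iff_ne_zero.2 two_ne_zero).map C

lemma mul_vecMulVec_mul_transpose (M : Matrix (Fin ℓ) (Fin ℓ) ℝ) (a : Fin ℓ → ℝ) :
    M * Matrix.vecMulVec a a * M.transpose = Matrix.vecMulVec (M.mulVec a) (M.mulVec a) := by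
  rw [Matrix.mul_vecMulVec, Matrix.vecMulVec_mul, Matrix.vecMul_transpose]

section Setup

variable (cox : CoxeterSetup ℓ t)

lemma mulVec_ne_zero (g : Matrix.GeneralLinearGroup (Fin ℓ) ℝ) {a : Fin ℓ → ℝ} (ha : a ≠ 0) :
    (g : Matrix (Fin ℓ) (Fin ℓ) ℝ).mulVec a ≠ 0 := by
  intro h
  apply ha
  have h1 := congrArg ((↑g⁻¹ : Matrix (Fin ℓ) (Fin ℓ) ℝ).mulVec) h
  rwa [Matrix.mulVec_mulVec, Units.inv_mul, Matrix.one_mulVec, Matrix.mulVec_zero] at h1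

lemma exists_mulVec_eq_smul {g : Matrix.GeneralLinearGroup (Fin ℓ) ℝ} (hg : g ∈ cox.W)
    {a : Fin ℓ → ℝ} (ha : a ∈ cox.A) :
    ∃ b ∈ cox.A, ∃ c : ℝ, c ≠ 0 ∧ (g : Matrix (Fin ℓ) (Fin ℓ) ℝ).mulVec a = c • b := by
  obtain ⟨s, hs, hsa⟩ := cox.hrefl a ha
  have hga := mulVec_ne_zero g (cox.hA0 a ha)
  obtain ⟨b, hb, c, hc⟩ := cox.hhyp (g * s * g⁻¹) (cox.W.mul_mem (cox.W.mul_mem hg hs)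
    (cox.W.inv_mem hg)) _ hga (by
      have h1 : (g : Matrix (Fin ℓ) (Fin ℓ) ℝ).mulVec a ⬝ᵥ
        (g : Matrix (Fin ℓ) (Fin ℓ) ℝ).mulVec a = a ⬝ᵥ a :=
        mulVec_dotProduct_mulVec (cox.hWorth g hg) a a
      rw [Units.val_mul, Units.val_mul, coe_inv_eq_transpose (cox.hWorth g hg), hsa, reflMat,
        reflMat, mul_sub, sub_mul, Matrix.mul_smul, Matrix.smul_mul, mul_vecMulVec_mul_transpose,
        mul_one, coe_mul_transpose_of_orthogonal (cox.hWorth g hg)]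
      congr 3
      exact h1.symm)
  refine ⟨b, hb, c, ?_, hc⟩
  rintro rfl
  exact hga (by rw [hc, zero_smul])

lemma orbForm_mem_InvVec (a : Fin ℓ → ℝ) : orbForm cox.hWfin a ∈ InvVec cox.W := by
  intro g hg
  have hO := cox.hWorth g hg
  funext x
  have h1 : ∀ h : Matrix.GeneralLinearGroup (Fin ℓ) ℝ,
      ∑ y, cF ((g : Matrix (Fin ℓ) (Fin ℓ) ℝ) x y) * fAct g
        (cF ((h : Matrix (Fin ℓ) (Fin ℓ) ℝ).mulVec a y) *
          (linF ((h : Matrix (Fin ℓ) (Fin ℓ) ℝ).mulVec a))⁻¹) =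
      cF (((g * h : Matrix.GeneralLinearGroup (Fin ℓ) ℝ) : Matrix (Fin ℓ) (Fin ℓ) ℝ).mulVec a x) *
        (linF (((g * h : Matrix.GeneralLinearGroup (Fin ℓ) ℝ) :
          Matrix (Fin ℓ) (Fin ℓ) ℝ).mulVec a))⁻¹ := by
    intro h
    rw [Units.val_mul, ← Matrix.mulVec_mulVec]
    simp only [map_mul, map_inv₀, fAct_cF, fAct_linF hO, ← mul_assoc, ← Finset.sum_mul, ← cF_mul,
      ← cF_sum]
    rfl
  simp only [vecAct, orbForm, map_sum, Finset.mul_sum]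
  rw [Finset.sum_comm, Finset.sum_congr rfl fun h _ => h1 h]
  refine Finset.sum_nbij' (fun h => g * h) (fun h => g⁻¹ * h) ?_ ?_ ?_ ?_ ?_
  · intro h hh
    simp only [Set.Finite.mem_toFinset, SetLike.mem_coe] at hh ⊢
    exact cox.W.mul_mem hg hh
  · intro h hh
    simp only [Set.Finite.mem_toFinset, SetLike.mem_coe] at hh ⊢
    exact cox.W.mul_mem (cox.W.inv_mem hg) hh
  · intro h _; simp
  · intro h _; simp
  · intro h _; rfl

lemma orbForm_mem_OmegaInf {a : Fin ℓ → ℝ} (ha : a ∈ cox.A) :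
    orbForm cox.hWfin a ∈ OmegaInf cox.A := by
  classical
  refine ⟨1, fun x => ?_, fun b hb x y => ?_⟩
  · rw [pow_one, orbForm, Finset.mul_sum]
    refine Sreg_sum fun g hg => ?_
    obtain ⟨d, hd, c, hc, h⟩ := exists_mulVec_eq_smul cox (cox.hWfin.mem_toFinset.1 hg) ha
    rw [h, mul_left_comm, linF_smul, mul_inv, mul_left_comm (QF _), ← div_eq_mul_inv (QF _),
      QF_div_linF cox.hA0 hd, ← cF_inv]
    exact Sreg_mul (cF_mem_Sreg _) (Sreg_mul (cF_mem_Sreg _) (toF_mem_Sreg _))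
  · rw [pow_one, orbForm, orbForm, Finset.mul_sum, Finset.mul_sum, ← Finset.sum_sub_distrib,
      Finset.mul_sum]
    refine Sreg_sum fun g hg => ?_
    obtain ⟨d, hd, c, hc, h⟩ := exists_mulVec_eq_smul cox (cox.hWfin.mem_toFinset.1 hg) ha
    rw [h, ← mul_assoc, ← mul_assoc, ← sub_mul, ← cF_mul, ← cF_mul, ← cF_sub, mul_left_comm]
    by_cases hbd : d = b
    · have h0 : b x * (c • d) y - b y * (c • d) x = 0 := by
        rw [hbd, Pi.smul_apply, Pi.smul_apply, smul_eq_mul, smul_eq_mul]; ring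
      rw [h0, cF_zero, zero_mul]
      exact ⟨0, map_zero _⟩
    · refine Sreg_mul (cF_mem_Sreg _) ?_
      rw [linF_smul, mul_inv, mul_left_comm, ← cF_inv, QF_div_linF cox.hA0 hb,
        ← Finset.mul_prod_erase _ _ (Finset.mem_erase.2 ⟨hbd, hd⟩), toF_mul, mul_comm, linF]
      rw [mul_comm _ (toF (linForm d))⁻¹, ← linF,
        inv_mul_cancel_left₀ (linF_ne_zero (cox.hA0 d hd))]
      exact Sreg_mul (toF_mem_Sreg _) (cF_mem_Sreg _)

lemma linF_inv_mem_Sloc {a b : Fin ℓ → ℝ} (h : ¬ linForm a ∣ linForm b) : (linF b)⁻¹ ∈ Sloc a :=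
  inv_toF_mem_Sloc h

lemma not_linForm_dvd_of_not_exists {a b : Fin ℓ → ℝ} (ha : a ≠ 0) (h : ¬ ∃ c : ℝ, b = c • a) :
    ¬ linForm a ∣ linForm b := fun hd => h (exists_smul_of_linForm_dvd ha hd)

lemma linF_mul_pairF_orbForm_mem {a b : Fin ℓ → ℝ} (ha : a ≠ 0) (hb : b ≠ 0) :
    linF b * pairF b (orbForm cox.hWfin a) ∈ Sloc b := by
  rw [pairF_orbForm, Finset.mul_sum]
  refine Sloc_sum hb fun g _ => ?_
  rw [mul_left_comm]
  refine Sloc_mul hb (cF_mem_Sloc hb _) ?_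
  have hga := mulVec_ne_zero g ha
  by_cases h : ∃ c : ℝ, (g : Matrix (Fin ℓ) (Fin ℓ) ℝ).mulVec a = c • b
  · obtain ⟨c, hc⟩ := h
    rw [hc, linF_smul, mul_inv, mul_left_comm, mul_inv_cancel₀ (linF_ne_zero hb), mul_one, ← cF_inv]
    exact cF_mem_Sloc hb _
  · exact Sloc_mul hb (toF_mem_Sloc hb _)
      (linF_inv_mem_Sloc (not_linForm_dvd_of_not_exists hb h))

lemma pairF_orbForm_mem {a b : Fin ℓ → ℝ} (hb : b ≠ 0)
    (hab : ∀ g ∈ cox.W, ¬ ∃ c : ℝ, (g : Matrix (Fin ℓ) (Fin ℓ) ℝ).mulVec a = c • b) :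
    pairF b (orbForm cox.hWfin a) ∈ Sloc b := by
  rw [pairF_orbForm]
  refine Sloc_sum hb fun g hg => Sloc_mul hb (cF_mem_Sloc hb _) (linF_inv_mem_Sloc
    (not_linForm_dvd_of_not_exists hb (hab g (cox.hWfin.mem_toFinset.1 hg))))

lemma pairF_orbForm_ne_zero {a : Fin ℓ → ℝ} (ha : a ≠ 0) : pairF a (orbForm cox.hWfin a) ≠ 0 := by
  classical
  intro h0
  have haa : a ⬝ᵥ a ≠ 0 := fun h => ha (dotProduct_self_eq_zero.1 h)
  let p : Matrix.GeneralLinearGroup (Fin ℓ) ℝ → Prop := fun g =>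
    ∃ c : ℝ, (g : Matrix (Fin ℓ) (Fin ℓ) ℝ).mulVec a = c • a
  rw [pairF_orbForm, ← Finset.sum_filter_add_sum_filter_not _ p] at h0
  have h1 : ∀ g ∈ cox.hWfin.toFinset.filter p,
      cF (a ⬝ᵥ (g : Matrix (Fin ℓ) (Fin ℓ) ℝ).mulVec a) *
        (linF ((g : Matrix (Fin ℓ) (Fin ℓ) ℝ).mulVec a))⁻¹ = cF (a ⬝ᵥ a) * (linF a)⁻¹ := by
    intro g hg
    obtain ⟨c, hc⟩ := (Finset.mem_filter.1 hg).2
    have hc0 : c ≠ 0 := by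
      rintro rfl
      exact mulVec_ne_zero g ha (by rw [hc, zero_smul])
    rw [hc, dotProduct_smul, linF_smul, smul_eq_mul, cF_mul, mul_inv, mul_mul_mul_comm,
      mul_inv_cancel₀ (cF_ne_zero hc0), one_mul]
  rw [Finset.sum_congr rfl h1, Finset.sum_const, nsmul_eq_mul] at h0
  have hn : ((cox.hWfin.toFinset.filter p).card : Ffield ℓ) ≠ 0 := by
    rw [Nat.cast_ne_zero, Finset.card_ne_zero]
    refine ⟨1, Finset.mem_filter.2 ⟨cox.hWfin.mem_toFinset.2 cox.W.one_mem, 1, ?_⟩⟩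
    rw [Units.val_one, Matrix.one_mulVec, one_smul]
  set n : ℕ := (cox.hWfin.toFinset.filter p).card with hn_def
  have h2 : (n : Ffield ℓ) * (cF (a ⬝ᵥ a) * (linF a)⁻¹) ∈ Sloc a := by
    rw [eq_neg_of_add_eq_zero_left h0]
    refine (slocSubring ha).neg_mem (Sloc_sum ha fun g hg => ?_)
    exact Sloc_mul ha (cF_mem_Sloc ha _) (linF_inv_mem_Sloc
      (not_linForm_dvd_of_not_exists ha (Finset.mem_filter.1 hg).2))
  have hncF : (n : Ffield ℓ) = cF n := by rw [cF_eq_algebraMap, map_natCast]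
  rw [hncF] at h2 hn
  have hn' : (n : ℝ) ≠ 0 := fun h => hn (by rw [h, cF_zero])
  have h3 := Sloc_mul ha (cF_mem_Sloc ha ((n : ℝ) * (a ⬝ᵥ a))⁻¹) h2
  rw [← mul_assoc (cF (n : ℝ)), ← cF_mul, ← mul_assoc, ← cF_mul,
    inv_mul_cancel₀ (mul_ne_zero hn' haa), cF_one, one_mul] at h3
  exact linF_inv_notMem_Sloc ha h3

end Setup

/-! ### The primitive derivation has a pole along every mirror -/

section Setup

variable (cox : CoxeterSetup ℓ t)

lemma matSub_reflMat_of_mem_InvPoly {p : Spoly ℓ} (hp : p ∈ InvPoly cox.W) {b : Fin ℓ → ℝ}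
    (hb : b ∈ cox.A) : matSub (reflMat b) p = p := by
  obtain ⟨s, hs, hsb⟩ := cox.hrefl b hb
  rw [← hsb]
  exact hp s hs

lemma contraction_mem_Sloc {ω : OmF ℓ} (hω : ω ∈ OmegaInf cox.A) {b : Fin ℓ → ℝ}
    (hb : b ∈ cox.A) (h : linF b * pairF b ω ∈ Sloc b) {p : Spoly ℓ} (hp : p ∈ InvPoly cox.W) :
    ∑ x, ω x * toF (pderiv x p) ∈ Sloc b := by
  have hb0 := cox.hA0 b hb
  have hbb : b ⬝ᵥ b ≠ 0 := fun h => hb0 (dotProduct_self_eq_zero.1 h)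
  have h1 : cF (b ⬝ᵥ b) * ∑ x, ω x * toF (pderiv x p) =
      pairF b ω * toF (∑ x, C (b x) * pderiv x p) +
      ∑ x, (∑ y, cF (b y) * (cF (b y) * ω x - cF (b x) * ω y)) * toF (pderiv x p) := by
    have h2 : ∀ x, ∑ y, cF (b y) * (cF (b y) * ω x - cF (b x) * ω y) =
        cF (b ⬝ᵥ b) * ω x - cF (b x) * pairF b ω := by
      intro x
      simp only [mul_sub, Finset.sum_sub_distrib, dotProduct, cF_sum, cF_mul, Finset.sum_mul,
        pairF, Finset.mul_sum, mul_assoc]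
      congr 1
      exact Finset.sum_congr rfl fun y _ => by ring
    have h3 : ∀ x, toF (C (b x) * pderiv x p) = cF (b x) * toF (pderiv x p) := fun x => by
      rw [toF_mul]; rfl
    simp only [h2, toF_sum, h3, Finset.mul_sum, ← Finset.sum_add_distrib]
    exact Finset.sum_congr rfl fun x _ => by ring
  have h2 : cF (b ⬝ᵥ b) * ∑ x, ω x * toF (pderiv x p) ∈ Sloc b := by
    rw [h1]
    refine Sloc_add hb0 ?_ (Sloc_sum hb0 fun x _ => Sloc_mul hb0 (Sloc_sum hb0 fun y _ =>
      Sloc_mul hb0 (cF_mem_Sloc hb0 _) (wedge_mem_Sloc cox.hA0 cox.hAprop hω hb y x))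
      (toF_mem_Sloc hb0 _))
    obtain ⟨q, hq⟩ := linForm_dvd_sum_pderiv hb0 (matSub_reflMat_of_mem_InvPoly cox hp hb)
    rw [hq, toF_mul, ← mul_assoc, mul_comm (pairF b ω)]
    exact Sloc_mul hb0 h (toF_mem_Sloc hb0 q)
  have h3 := Sloc_mul hb0 (cF_mem_Sloc hb0 (b ⬝ᵥ b)⁻¹) h2
  rwa [← mul_assoc, ← cF_mul, inv_mul_cancel₀ hbb, cF_one, one_mul] at h3

lemma fAct_dilation_linF (b : Fin ℓ → ℝ) : fAct (dilation ℓ) (linF b) = 2 * linF b := by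
  rw [linF, fAct_dilation_of_isHomogeneous (linForm_isHomogeneous b), pow_one]

variable (D : Derivation ℝ (Ffield ℓ) (Ffield ℓ))
  (hDP : ∀ c, D (toF (cox.P c)) = if c = cox.top (cox.blk c) then 1 else 0)

include hDP

lemma derivation_even_mem_Sloc {b : Fin ℓ → ℝ} (hb : b ≠ 0) :
    ∀ y : Spoly ℓ, matSub (reflMat b) y = y → D (toF y) ∈ Sloc b := fun _ hy =>
  derivation_mem_Sloc_of_invariants cox.hWfin cox.hWorth hb D (primitive_mem_Sreg cox D hDP) hy

lemma fAct_dilation_nabVec_orbForm {a : Fin ℓ → ℝ} (ha : a ∈ cox.A) (x : Fin ℓ) :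
    2 ^ (cox.deg (cox.top (cox.blk x)) + 1) *
      fAct (dilation ℓ) (nabVec D (orbForm cox.hWfin a) x) =
      nabVec D (orbForm cox.hWfin a) x := by
  simp only [nabVec, orbForm, map_sum, Finset.mul_sum]
  refine Finset.sum_congr rfl fun g hg => ?_
  obtain ⟨b, hb, c, hc, h⟩ := exists_mulVec_eq_smul cox (cox.hWfin.mem_toFinset.1 hg) ha
  set v := (g : Matrix (Fin ℓ) (Fin ℓ) ℝ).mulVec a with hv
  have ha0 := cox.hA0 a ha
  have hv0 : v ≠ 0 := mulVec_ne_zero g ha0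
  by_cases hvx : v x = 0
  · rw [hvx, cF_zero, zero_mul, map_zero, map_zero, mul_zero]
  have hblk : ∀ y, v y ≠ 0 → cox.blk y = cox.blk x := by
    obtain ⟨i, hi⟩ := cox.hblkA b hb
    have hi' : ∀ y, v y ≠ 0 → cox.blk y = i := fun y hy => hi y fun h0 => hy (by
      rw [h, Pi.smul_apply, h0, smul_zero])
    intro y hy
    rw [hi' y hy, hi' x hvx]
  have h1 := fAct_dilation_primitive_linF cox D hDP ha0 hblk
  have h2 : (2 : Ffield ℓ) ≠ 0 := two_ne_zero
  have h3 := linF_ne_zero hv0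
  rw [derivation_cF_mul, Derivation.leibniz_inv]
  simp only [map_mul, map_neg, map_pow, map_inv₀, fAct_cF, smul_eq_mul, fAct_dilation_linF]
  rw [pow_succ]
  calc _ = -(cF (v x) * (2 * ((2 * linF v)⁻¹ ^ 2 *
        (2 ^ cox.deg (cox.top (cox.blk x)) * fAct (dilation ℓ) (D (linF v)))))) := by ring
    _ = _ := by
      rw [h1]
      field_simp

lemma primitive_linF_notMem_Sloc (e : Equiv.Perm {ω : OmF ℓ // ω ∈ OmegaInfW cox.A cox.W})
    (he : ∀ ω, (e ω : OmF ℓ) = nabVec D (ω : OmF ℓ)) {a : Fin ℓ → ℝ} (ha : a ∈ cox.A) :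
    D (linF a) ∉ Sloc a := by
  intro hbad
  have ha0 := cox.hA0 a ha
  set ω := orbForm cox.hWfin a with hω
  have hωinv : ω ∈ InvVec cox.W := orbForm_mem_InvVec cox a
  let w : {ω : OmF ℓ // ω ∈ OmegaInfW cox.A cox.W} := ⟨ω, orbForm_mem_OmegaInf cox ha, hωinv⟩
  set η := nabVec D ω with hη
  have hηmem : η ∈ OmegaInfW cox.A cox.W := by
    have h := (e w).2
    rwa [he w] at h
  have hlocal_a : linF a * pairF a η ∈ Sloc a := by
    obtain ⟨s, hs, hsa⟩ := cox.hrefl a ha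
    set f := pairF a ω with hf
    have hodd : fAct s f = -f := fAct_pairF_of_reflMat ha0 hsa (hωinv s hs)
    have hodd' : fAct s (D f) = -D f := by
      have := fAct_pairF_of_reflMat ha0 hsa (hηmem.2 s hs)
      rwa [hη, pairF_nabVec] at this
    have hw : linF a * f ∈ Sloc a := linF_mul_pairF_orbForm_mem cox ha0 ha0
    have hweven : fAct s (linF a * f) = linF a * f := by
      rw [map_mul, hodd, fAct_reflMat_linF ha0 hsa, neg_mul_neg]
    have hDw := derivation_mem_Sloc_of_even ha0 hsa (derivation_even_mem_Sloc cox D hDP ha0)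
      hw hweven
    have h1 : linF a ^ (2 : ℤ) * D f = linF a * D (linF a * f) - linF a * f * D (linF a) := by
      rw [Derivation.leibniz, smul_eq_mul, smul_eq_mul, zpow_ofNat]; ring
    have h2 : linF a ^ (2 : ℤ) * D f ∈ Sloc a := by
      rw [h1]
      exact Sloc_sub ha0 (Sloc_mul ha0 (toF_mem_Sloc ha0 _) hDw) (Sloc_mul ha0 hw hbad)
    have h3 := linF_zpow_pred_mul_mem_of_even ha0 hsa hodd' (by decide) h2
    rw [hη, pairF_nabVec]
    simpa using h3
  have hlocal : ∀ b ∈ cox.A, linF b * pairF b η ∈ Sloc b := by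
    intro b hb
    have hb0 := cox.hA0 b hb
    by_cases hab : ∃ g ∈ cox.W, ∃ c : ℝ, (g : Matrix (Fin ℓ) (Fin ℓ) ℝ).mulVec a = c • b
    · obtain ⟨g, hg, c, hc⟩ := hab
      have hc0 : c ≠ 0 := by
        rintro rfl
        exact mulVec_ne_zero g ha0 (by rw [hc, zero_smul])
      have h1 := fAct_mem_Sloc (cox.hWorth g hg) hlocal_a
      rw [map_mul, fAct_linF (cox.hWorth g hg), ← pairF_mulVec (cox.hWorth g hg) (hηmem.2 g hg),
        hc, linF_smul, pairF_smul] at h1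
      obtain ⟨p, q, hq, hpq⟩ := h1
      rw [linForm_smul] at hq
      have h2 : linF b * pairF b η = cF (c * c)⁻¹ *
          (cF c * linF b * (cF c * pairF b η)) := by
        rw [cF_inv, cF_mul]
        have := cF_ne_zero (ℓ := ℓ) hc0
        field_simp
      rw [h2]
      refine Sloc_mul hb0 (cF_mem_Sloc hb0 _) ⟨p, q, fun hd => hq ?_, hpq⟩
      have hu : IsUnit (C c : Spoly ℓ) := (isUnit_iff_ne_zero.2 hc0).map C
      exact (hu.mul_left_dvd).2 hd
    · obtain ⟨s, hs, hsb⟩ := cox.hrefl b hb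
      have hodd := fAct_pairF_of_reflMat hb0 hsb (hωinv s hs)
      have hodd' := fAct_pairF_of_reflMat hb0 hsb (hηmem.2 s hs)
      have h1 : pairF b ω ∈ Sloc b := pairF_orbForm_mem cox hb0 fun g hg hc => hab ⟨g, hg, hc⟩
      have h2 := derivation_order_le (n := 0) hb0 hsb (derivation_even_mem_Sloc cox D hDP hb0) hodd
        (by simpa using h1)
      rw [← pairF_nabVec] at h2
      have h3 := linF_zpow_pred_mul_mem_of_even hb0 hsb hodd' (by decide) h2
      simpa using h3
  have hN : ∀ c, ∑ x, η x * toF (pderiv x (cox.P c)) = 0 := by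
    intro c
    have h1 : ∑ x, η x * toF (pderiv x (cox.P c)) ∈ Sreg ℓ := by
      obtain ⟨N, hreg, -⟩ := hηmem.1
      refine mem_Sreg_of_forall_mem_Sloc cox.A cox.hA0 (N := N) ?_ fun b hb =>
        contraction_mem_Sloc cox hηmem.1 hb (hlocal b hb) (cox.hPinv c)
      rw [Finset.mul_sum]
      refine Sreg_sum fun x _ => ?_
      rw [← mul_assoc]
      exact Sreg_mul (hreg x) (toF_mem_Sreg _)
    have hle : cox.deg c ≤ cox.deg (cox.top (cox.blk c)) := by
      by_cases h : c = cox.top (cox.blk c)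
      · rw [← h]
      · exact (cox.htopdeg _ c rfl h).le
    obtain ⟨k, hk⟩ := Nat.exists_eq_add_of_le hle
    refine eq_zero_of_fAct_dilation h1 (k := k + 2) (by lia) ?_
    rw [map_sum, Finset.mul_sum]
    refine Finset.sum_congr rfl fun x _ => ?_
    by_cases hx : cox.blk x = cox.blk c
    · have h2 := fAct_dilation_nabVec_orbForm cox D hDP ha x
      rw [hx, hk, ← hω, ← hη] at h2
      rw [map_mul, fAct_dilation_of_isHomogeneous (cox.hPhom c).pderiv]
      obtain ⟨d, hd⟩ := Nat.exists_eq_succ_of_ne_zero (cox.hdeg c).ne'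
      rw [hd] at h2 ⊢
      calc _ = 2 ^ (d.succ + k + 1) * fAct (dilation ℓ) (η x) * toF (pderiv x (cox.P c)) := by
            rw [Nat.succ_sub_one, Nat.succ_eq_add_one]; ring
        _ = _ := by rw [h2]
    · rw [pderiv_eq_zero_of_blockPoly (cox.hPblock c) hx]; simp
  have hη0 : η = 0 := by
    have h1 : mkDerivation ℝ η = 0 := by
      refine derivation_ext_of_basic cox ha0 fun c => ?_
      rw [derivation_apply_eq_sum, Derivation.zero_apply, ← hN c]
      exact Finset.sum_congr rfl fun x _ => by rw [mkDerivation_X, mul_comm]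
    funext x
    rw [← mkDerivation_X ℝ η x, h1]; rfl
  have hzero : (0 : OmF ℓ) ∈ OmegaInfW cox.A cox.W := by
    have h1 : (0 : Ffield ℓ) ∈ Sreg ℓ := ⟨0, map_zero _⟩
    refine ⟨⟨0, fun x => ?_, fun b _ x y => ?_⟩, fun g _ => ?_⟩
    · simpa using h1
    · simpa using h1
    · funext x; simp [vecAct]
  have hew : e w = e ⟨0, hzero⟩ := by
    apply Subtype.ext
    rw [he, he]
    change η = _
    rw [hη0]
    funext x; simp [nabVec]
  have hω0 : ω = 0 := congrArg Subtype.val (e.injective hew)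
  exact pairF_orbForm_ne_zero cox ha0 (by rw [← hω, hω0]; simp [pairF])

/-- On `Ω(A,∞)^W`, the connection `∇_D` shifts the multiplicity by exactly two. -/
lemma apply_mem_OmegaMult_iff (e : Equiv.Perm {ω : OmF ℓ // ω ∈ OmegaInfW cox.A cox.W})
    (he : ∀ ω, (e ω : OmF ℓ) = nabVec D (ω : OmF ℓ)) (m : (Fin ℓ → ℝ) → ℤ)
    (w : {ω : OmF ℓ // ω ∈ OmegaInfW cox.A cox.W}) :
    (e w : OmF ℓ) ∈ OmegaMult cox.A (fun a => m a + 2) ↔ (w : OmF ℓ) ∈ OmegaMult cox.A m := by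
  rw [mem_OmegaMult_iff cox.hA0 cox.hAprop (e w).2.1, mem_OmegaMult_iff cox.hA0 cox.hAprop w.2.1]
  refine forall₂_congr fun a ha => ?_
  have ha0 := cox.hA0 a ha
  obtain ⟨s, hs, hsa⟩ := cox.hrefl a ha
  have hodd := fAct_pairF_of_reflMat ha0 hsa (w.2.2 s hs)
  have hD := derivation_even_mem_Sloc cox D hDP ha0
  rw [he, pairF_nabVec]
  obtain ⟨N, hN⟩ := exists_linF_pow_mul_pairF_mem cox.hA0 cox.hAprop w.2.1 ha
  exact ⟨order_le_of_derivation_order_le ha0 hsa hD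
    (primitive_linF_notMem_Sloc cox D hDP e he ha) hodd hN, derivation_order_le ha0 hsa hD hodd⟩

lemma zpow_apply_mem_OmegaMult_iff (e : Equiv.Perm {ω : OmF ℓ // ω ∈ OmegaInfW cox.A cox.W})
    (he : ∀ ω, (e ω : OmF ℓ) = nabVec D (ω : OmF ℓ)) (k : ℤ) (m : (Fin ℓ → ℝ) → ℤ)
    (w : {ω : OmF ℓ // ω ∈ OmegaInfW cox.A cox.W}) :
    ((e ^ k) w : OmF ℓ) ∈ OmegaMult cox.A (fun a => m a + 2 * k) ↔
      (w : OmF ℓ) ∈ OmegaMult cox.A m := by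
  induction k using Int.induction_on generalizing m w with
  | zero => simp
  | succ k ih =>
    have h1 := apply_mem_OmegaMult_iff cox D hDP e he (fun a => m a + 2 * (k : ℤ))
      ((e ^ (k : ℤ)) w)
    have h2 : (fun a => m a + 2 * (k : ℤ) + 2) = fun a => m a + 2 * ((k : ℤ) + 1) := by
      funext a; ring
    rw [← Equiv.Perm.mul_apply, ← zpow_one_add, add_comm 1, h2] at h1
    exact h1.trans (ih m w)
  | pred k ih =>
    have h1 := apply_mem_OmegaMult_iff cox D hDP e he (fun a => m a + 2 * (-(k : ℤ) - 1))
      ((e ^ (-(k : ℤ) - 1)) w)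
    have h2 : (fun a => m a + 2 * (-(k : ℤ) - 1) + 2) = fun a => m a + 2 * -(k : ℤ) := by
      funext a; ring
    rw [← Equiv.Perm.mul_apply, ← zpow_one_add, add_sub_cancel, h2] at h1
    exact h1.symm.trans (ih m w)

lemma PFilt_eq (e : Equiv.Perm {ω : OmF ℓ // ω ∈ OmegaInfW cox.A cox.W})
    (he : ∀ ω, (e ω : OmF ℓ) = nabVec D (ω : OmF ℓ)) (m : (Fin ℓ → ℝ) → ℤ) (k : ℤ) :
    PFilt e m k = OmegaMultW cox.A cox.W (fun a => m a + 2 * k) := by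
  ext ω
  constructor
  · rintro ⟨_, ⟨w, hw, rfl⟩, rfl⟩
    exact ⟨(zpow_apply_mem_OmegaMult_iff cox D hDP e he k m w).2 hw, ((e ^ k) w).2.2⟩
  · rintro ⟨hω, hinv⟩
    let w : {ω : OmF ℓ // ω ∈ OmegaInfW cox.A cox.W} := ⟨ω, hω.1, hinv⟩
    have h1 : (e ^ k) ((e ^ k).symm w) = w := (e ^ k).apply_symm_apply w
    refine ⟨w, ⟨(e ^ k).symm w, ?_, h1⟩, rfl⟩
    refine (zpow_apply_mem_OmegaMult_iff cox D hDP e he k m _).1 ?_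
    rw [h1]
    exact hω

end Setup

lemma OmegaMultW_mono (cox : CoxeterSetup ℓ t) {m n : (Fin ℓ → ℝ) → ℤ} (h : ∀ a, m a ≤ n a) :
    OmegaMultW cox.A cox.W m ⊆ OmegaMultW cox.A cox.W n := by
  rintro ω ⟨hω, hinv⟩
  refine ⟨(mem_OmegaMult_iff cox.hA0 cox.hAprop hω.1 n).2 fun a ha => ?_, hinv⟩
  exact linF_zpow_mul_mem_mono (cox.hA0 a ha) (h a)
    ((mem_OmegaMult_iff cox.hA0 cox.hAprop hω.1 m).1 hω a ha)

/-- Theorem 1.3: the primitive filtration of `Ω(A,∞)^W` induced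
from an arbitrary multiplicity `m` is increasing and
`P^{(m)}_k = P^{(m+2k)}_0 = Ω(A, m+2k)^W`. -/
theorem stmt1 (cox : CoxeterSetup ℓ t)
    (DFi : Fin t → Derivation ℝ (Ffield ℓ) (Ffield ℓ))
    (hDFi : ∀ i c, DFi i (toF (cox.P c)) = if c = cox.top i then 1 else 0)
    (D : Derivation ℝ (Ffield ℓ) (Ffield ℓ)) (hD : D = ∑ i, DFi i)
    (e : Equiv.Perm {ω : OmF ℓ // ω ∈ OmegaInfW cox.A cox.W})
    (he : ∀ ω, (e ω : OmF ℓ) = nabVec D (ω : OmF ℓ))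
    (m : (Fin ℓ → ℝ) → ℤ) :
    (∀ k : ℤ, PFilt e m k ⊆ PFilt e m (k + 1)) ∧
    (∀ k : ℤ, PFilt e m k = PFilt e (fun a => m a + 2 * k) 0 ∧
      PFilt e m k = OmegaMultW cox.A cox.W (fun a => m a + 2 * k)) := by
  have hDP : ∀ c, D (toF (cox.P c)) = if c = cox.top (cox.blk c) then 1 else 0 := by
    intro c
    have h1 : D (toF (cox.P c)) = ∑ i, DFi i (toF (cox.P c)) := by
      rw [hD]
      have := congrFun (map_sum Derivation.coeFnAddMonoidHom DFi Finset.univ) (toF (cox.P c))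
      rw [Finset.sum_apply] at this
      exact this
    rw [h1, Finset.sum_congr rfl fun i _ => hDFi i c, Finset.sum_eq_single (cox.blk c)]
    · intro i _ hi
      rw [if_neg]
      rintro rfl
      exact hi (cox.htop i).symm
    · simp
  refine ⟨fun k => ?_, fun k => ⟨?_, PFilt_eq cox D hDP e he m k⟩⟩
  · rw [PFilt_eq cox D hDP e he, PFilt_eq cox D hDP e he]
    exact OmegaMultW_mono cox fun a => by lia
  · rw [PFilt_eq cox D hDP e he, PFilt_eq cox D hDP e he]
    simp only [mul_zero, add_zero]

end Statements
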